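/- arXiv:2011.10636 — 7 statements merged into one kernel-verified Lean document; each statement's English description precedes it below -/
import Mathlib

section
/- Under the setup, assume additionally that the range of B is closed in Q' and that the inf-sup condition with constant β > 0 holds, i.e. ‖B*q‖_{V'} ≥ β‖q‖_Q for all q in the orthogonal complement H⊥ of H in Q and ‖Bv‖_{Q'} ≥ β‖v‖_V for all v in the orthogonal complement K⊥ of K in V. Then for every f ∈ L¹(J;V') and g ∈ L¹(J;Q'), Problem (P) has exactly one solution (u,p) ∈ L¹(J;V) × L¹(J;Q), and there exists a constant C > 0, depending only on α₀, β, γ₀, ‖a‖, ‖b‖, ‖c‖, C_{k₁}, C_{k₂}, C_{k₃}, C_{k₄} and T (uniformly over all spaces, forms, kernels and data satisfying these bounds), such that ‖u‖_{L¹(J;V)} + ‖p‖_{L¹(J;Q)} ≤ C (‖f‖_{L¹(J;V')} + ‖g‖_{L¹(J;Q')}). -/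
open MeasureTheory

/-- `(u, p)` solves the Volterra mixed Problem (P) with data `f`, `g` on `J = [0,T]`. -/
def SolvesP (V Q : Type) [NormedAddCommGroup V] [NormedSpace ℝ V]
    [NormedAddCommGroup Q] [NormedSpace ℝ Q] (T : ℝ)
    (a : V →L[ℝ] V →L[ℝ] ℝ) (b : V →L[ℝ] Q →L[ℝ] ℝ) (c : Q →L[ℝ] Q →L[ℝ] ℝ)
    (k₁ k₂ k₃ k₄ : ℝ → ℝ → ℝ) (f : ℝ → V →L[ℝ] ℝ) (g : ℝ → Q →L[ℝ] ℝ)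
    (u : ℝ → V) (p : ℝ → Q) : Prop :=
  ∀ᵐ t ∂volume, t ∈ Set.Icc (0:ℝ) T →
    (∀ v : V, a (u t) v + b v (p t)
        = f t v + ∫ s in (0:ℝ)..t, (k₁ t s * a (u s) v + k₂ t s * b v (p s))) ∧
    (∀ q : Q, b (u t) q - c (p t) q
        = g t q + ∫ s in (0:ℝ)..t, (k₃ t s * b (u s) q - k₄ t s * c (p s) q))

lemma aux_sq_bound {X : Type} [NormedAddCommGroup X] [NormedSpace ℝ X]
    (a : X →L[ℝ] X →L[ℝ] ℝ) (N : ℝ) (hs : ∀ v w, a v w = a w v) (hp : ∀ v, 0 ≤ a v v)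
    (hN : ‖a‖ ≤ N) (v w : X) : (a v w) ^ 2 ≤ a v v * (N * ‖w‖ ^ 2) := by
  have h1 : a w w ≤ N * ‖w‖ ^ 2 := by
    calc a w w ≤ ‖a w w‖ := le_abs_self _
      _ ≤ ‖a‖ * ‖w‖ * ‖w‖ := a.le_opNorm₂ w w
      _ ≤ N * ‖w‖ * ‖w‖ := by gcongr
      _ = _ := by ring
  have h2 : (a v w) ^ 2 ≤ a v v * a w w := by
    have := discrim_le_zero (a := a w w) (b := 2 * a v w) (c := a v v) (fun x => by
      have := hp (v + x • w)
      simp only [map_add, map_smul, add_apply,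
        smul_apply, smul_eq_mul] at this
      rw [hs w v] at this
      nlinarith)
    unfold discrim at this
    nlinarith
  exact h2.trans (mul_le_mul_of_nonneg_left h1 (hp v))

/-- half of the static estimate -/
lemma aux_half {X Y : Type} [NormedAddCommGroup X] [InnerProductSpace ℝ X] [CompleteSpace X]
    [NormedAddCommGroup Y] [InnerProductSpace ℝ Y]
    (a : X →L[ℝ] X →L[ℝ] ℝ) (b : X →L[ℝ] Y →L[ℝ] ℝ) (c : Y →L[ℝ] Y →L[ℝ] ℝ)
    (α β Na Nc : ℝ) (hα : 0 < α) (hβ : 0 < β) (hNa : 0 ≤ Na) (hNc : 0 ≤ Nc)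
    (_has : ∀ v w, a v w = a w v) (hap : ∀ v, 0 ≤ a v v)
    (hcs : ∀ v w, c v w = c w v) (hcp : ∀ v, 0 ≤ c v v)
    (ha : ‖a‖ ≤ Na) (hc : ‖c‖ ≤ Nc)
    (hK : ∀ v ∈ LinearMap.ker (b : X →ₗ[ℝ] Y →L[ℝ] ℝ), α * ‖v‖ ^ 2 ≤ a v v)
    (hi : ∀ v ∈ (LinearMap.ker (b : X →ₗ[ℝ] Y →L[ℝ] ℝ))ᗮ, β * ‖v‖ ≤ ‖b v‖)
    (u : X) (p : Y) (F S : ℝ) (hF : 0 ≤ F) (h : ∀ q, |b u q| ≤ F * ‖q‖ + |c p q|)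
    (hS : S = F ^ 2 + (a u u + c p p)) :
    ‖u‖ ^ 2 ≤ (2 * (2 / α * (1 + Na * (2 * (1 + Nc) / β ^ 2)) + 2 * (1 + Nc) / β ^ 2)) * S := by
  have hcl : IsClosed ((LinearMap.ker (b : X →ₗ[ℝ] Y →L[ℝ] ℝ) : Submodule ℝ X) : Set X) :=
    ContinuousLinearMap.isClosed_ker b
  have : CompleteSpace (LinearMap.ker (b : X →ₗ[ℝ] Y →L[ℝ] ℝ)) := hcl.completeSpace_coe
  obtain ⟨u0, hu0, w, hw, rfl⟩ :=
    Submodule.exists_add_mem_mem_orthogonal (K := LinearMap.ker (b : X →ₗ[ℝ] Y →L[ℝ] ℝ)) u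
  have hb0 : b u0 = 0 := by simpa using hu0
  have hbu : b (u0 + w) = b w := by rw [map_add, hb0, zero_add]
  set E := c p p with hE
  have hE0 : 0 ≤ E := hcp p
  have hA0 := hap (u0 + w)
  have h1 : ‖b w‖ ≤ F + Real.sqrt (Nc * E) := by
    refine ContinuousLinearMap.opNorm_le_bound _ (by positivity) fun q => ?_
    have h2 := h q
    rw [hbu] at h2
    have h3 : |c p q| ≤ Real.sqrt (Nc * E) * ‖q‖ := by
      apply abs_le_of_sq_le_sq' _ (by positivity) |> abs_le.mpr
      rw [mul_pow, Real.sq_sqrt (by positivity)]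
      have := aux_sq_bound c Nc hcs hcp hc p q
      nlinarith
    rw [Real.norm_eq_abs]
    linarith
  have h2 := (hi w hw).trans h1
  have h3 : (β * ‖w‖) ^ 2 ≤ 2 * (1 + Nc) * S := by
    have h4 : (β * ‖w‖) ^ 2 ≤ (F + Real.sqrt (Nc * E)) ^ 2 :=
      pow_le_pow_left₀ (by positivity) h2 2
    have h5 := Real.sq_sqrt (show 0 ≤ Nc * E by positivity)
    have h6 := mul_nonneg hNc hA0
    have h7 := mul_nonneg hNc (sq_nonneg F)
    rw [hS]
    nlinarith [sq_nonneg (F - Real.sqrt (Nc * E))]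
  have h4 : ‖w‖ ^ 2 ≤ 2 * (1 + Nc) / β ^ 2 * S := by
    rw [div_mul_eq_mul_div, le_div_iff₀ (by positivity)]
    linarith [mul_pow β ‖w‖ 2]
  set D := 2 * (1 + Nc) / β ^ 2 with hD
  have h5 : a w w ≤ Na * ‖w‖ ^ 2 := by
    calc a w w ≤ ‖a w w‖ := le_abs_self _
      _ ≤ ‖a‖ * ‖w‖ * ‖w‖ := a.le_opNorm₂ w w
      _ ≤ Na * ‖w‖ * ‖w‖ := by gcongr
      _ = _ := by ring
  have h6 : a u0 u0 ≤ 2 * a (u0 + w) (u0 + w) + 2 * a w w := by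
    have := hap (u0 + w + w)
    simp only [map_add, add_apply] at this ⊢
    linarith
  have h7 := hK u0 hu0
  have h8 : α * ‖u0‖ ^ 2 ≤ 2 * (1 + Na * D) * S := by
    have : Na * ‖w‖ ^ 2 ≤ Na * (D * S) := mul_le_mul_of_nonneg_left h4 hNa
    have : a (u0 + w) (u0 + w) ≤ S := by rw [hS]; nlinarith
    nlinarith
  have h9 : ‖u0‖ ^ 2 ≤ 2 / α * (1 + Na * D) * S := by
    rw [div_mul_eq_mul_div, div_mul_eq_mul_div, le_div_iff₀ hα]
    linarith
  have h10 : ‖u0 + w‖ ^ 2 ≤ (‖u0‖ + ‖w‖) ^ 2 := pow_le_pow_left₀ (norm_nonneg _) (norm_add_le _ _) 2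
  nlinarith [sq_nonneg (‖u0‖ - ‖w‖)]

/-- static constant -/
noncomputable def statD (α β γ Na Nc : ℝ) : ℝ :=
  2 * ((2 * (2 / α * (1 + Na * (2 * (1 + Nc) / β ^ 2)) + 2 * (1 + Nc) / β ^ 2)) +
    (2 * (2 / γ * (1 + Nc * (2 * (1 + Na) / β ^ 2)) + 2 * (1 + Na) / β ^ 2)))

lemma static_bound {V Q : Type} [NormedAddCommGroup V] [InnerProductSpace ℝ V] [CompleteSpace V]
    [NormedAddCommGroup Q] [InnerProductSpace ℝ Q] [CompleteSpace Q]
    (a : V →L[ℝ] V →L[ℝ] ℝ) (b : V →L[ℝ] Q →L[ℝ] ℝ) (c : Q →L[ℝ] Q →L[ℝ] ℝ)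
    (α β γ Na Nc : ℝ) (hα : 0 < α) (hβ : 0 < β) (hγ : 0 < γ) (hNa : 0 ≤ Na) (hNc : 0 ≤ Nc)
    (has : ∀ v w, a v w = a w v) (hap : ∀ v, 0 ≤ a v v)
    (hcs : ∀ v w, c v w = c w v) (hcp : ∀ v, 0 ≤ c v v)
    (ha : ‖a‖ ≤ Na) (hc : ‖c‖ ≤ Nc)
    (hK : ∀ v ∈ LinearMap.ker (b : V →ₗ[ℝ] Q →L[ℝ] ℝ), α * ‖v‖ ^ 2 ≤ a v v)
    (hH : ∀ q ∈ LinearMap.ker (b.flip : Q →ₗ[ℝ] V →L[ℝ] ℝ), γ * ‖q‖ ^ 2 ≤ c q q)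
    (hi' : ∀ q ∈ (LinearMap.ker (b.flip : Q →ₗ[ℝ] V →L[ℝ] ℝ))ᗮ, β * ‖q‖ ≤ ‖b.flip q‖)
    (hi : ∀ v ∈ (LinearMap.ker (b : V →ₗ[ℝ] Q →L[ℝ] ℝ))ᗮ, β * ‖v‖ ≤ ‖b v‖)
    (u : V) (p : Q) :
    ‖u‖ + ‖p‖ ≤ (statD α β γ Na Nc + 1) * (‖a u + b.flip p‖ + ‖b u - c p‖) := by
  set f := a u + b.flip p with hf
  set g := b u - c p with hg
  set F := ‖f‖ + ‖g‖ with hF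
  have hF0 : 0 ≤ F := by positivity
  have hfF : ‖f‖ ≤ F := by rw [hF]; linarith [norm_nonneg g]
  have hgF : ‖g‖ ≤ F := by rw [hF]; linarith [norm_nonneg f]
  have hfv : ∀ v, |f v| ≤ F * ‖v‖ := fun v =>
    (f.le_opNorm v).trans (mul_le_mul_of_nonneg_right hfF (norm_nonneg _))
  have hgv : ∀ v, |g v| ≤ F * ‖v‖ := fun v =>
    (g.le_opNorm v).trans (mul_le_mul_of_nonneg_right hgF (norm_nonneg _))
  set E := a u u + c p p with hE
  have h1 := aux_half a b c α β Na Nc hα hβ hNa hNc has hap hcs hcp ha hc hK hi u p F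
    (F ^ 2 + E) hF0 (fun q => by
      have : b u q = g q + c p q := by simp [hg]
      rw [this]
      exact (abs_add_le _ _).trans (by linarith [hgv q])) rfl
  have h2 := aux_half c b.flip a γ β Nc Na hγ hβ hNc hNa hcs hcp has hap hc ha hH hi' p u F
    (F ^ 2 + E) hF0 (fun q => by
      have : b.flip p q = f q + -a u q := by simp [hf]
      rw [this]
      exact (abs_add_le _ _).trans (by rw [abs_neg]; linarith [hfv q])) (by rw [hE]; ring)
  have h3 : E ≤ F * (‖u‖ + ‖p‖) := by
    have : E = f u - g p := by simp [hf, hg, hE]; ring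
    have := le_abs_self (f u)
    have := neg_abs_le (g p)
    have := hfv u
    have := hgv p
    linarith
  set D := statD α β γ Na Nc with hD
  have hD0 : 0 ≤ D := by rw [hD]; unfold statD; positivity
  set R := ‖u‖ + ‖p‖ with hR
  have h4 : R ^ 2 ≤ D * (F ^ 2 + E) := by
    have : R ^ 2 ≤ 2 * (‖u‖ ^ 2 + ‖p‖ ^ 2) := by rw [hR]; nlinarith [sq_nonneg (‖u‖ - ‖p‖)]
    rw [hD]; unfold statD
    linarith
  have h5 : D * E ≤ D * (F * R) := mul_le_mul_of_nonneg_left h3 hD0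
  refine le_of_sq_le_sq ?_ (by positivity) |> id
  nlinarith [sq_nonneg (R - D * F), sq_nonneg F]

lemma static_surj {V Q : Type} [NormedAddCommGroup V] [InnerProductSpace ℝ V] [CompleteSpace V]
    [NormedAddCommGroup Q] [InnerProductSpace ℝ Q] [CompleteSpace Q]
    (a : V →L[ℝ] V →L[ℝ] ℝ) (b : V →L[ℝ] Q →L[ℝ] ℝ) (c : Q →L[ℝ] Q →L[ℝ] ℝ)
    (has : ∀ v w, a v w = a w v) (hcs : ∀ v w, c v w = c w v) (C : ℝ) (hC : 0 ≤ C)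
    (hb : ∀ u p, ‖u‖ + ‖p‖ ≤ C * (‖a u + b.flip p‖ + ‖b u - c p‖))
    (f : V →L[ℝ] ℝ) (g : Q →L[ℝ] ℝ) : ∃ u p, a u + b.flip p = f ∧ b u - c p = g := by
  let RV := (InnerProductSpace.toDual ℝ V).symm
  let RQ := (InnerProductSpace.toDual ℝ Q).symm
  let S : (WithLp 2 (V × Q)) →ₗ[ℝ] (WithLp 2 (V × Q)) :=
    { toFun := fun w => WithLp.toLp 2 (RV (a w.fst + b.flip w.snd), RQ (b w.fst - c w.snd))
      map_add' := fun x y => by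
        simp only [WithLp.add_fst, WithLp.add_snd, map_add, map_sub]
        refine Eq.trans ?_ (WithLp.toLp_add _ _ _)
        rw [Prod.mk_add_mk]
        congr 2 <;> abel
      map_smul' := fun r x => by
        simp only [WithLp.smul_fst, WithLp.smul_snd, map_add, map_sub, map_smul, RingHom.id_apply]
        refine Eq.trans ?_ (WithLp.toLp_smul _ _ _)
        rw [Prod.smul_mk, smul_add, smul_sub] }
  have hSin : ∀ w w' : (WithLp 2 (V × Q)), inner ℝ (S w) w' =
      a w.fst w'.fst + b w'.fst w.snd + (b w.fst w'.snd - c w.snd w'.snd) := by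
    intro w w'
    rw [WithLp.prod_inner_apply]
    simp only [S, LinearMap.coe_mk, AddHom.coe_mk, RV, RQ]
    rw [InnerProductSpace.toDual_symm_apply, InnerProductSpace.toDual_symm_apply]
    simp
  have hSsym : ∀ w w' : (WithLp 2 (V × Q)), inner ℝ (S w) w' = inner ℝ w (S w') := by
    intro w w'
    rw [hSin, real_inner_comm, hSin, has w.fst, hcs w.snd]
    ring
  have hnfst : ∀ w : (WithLp 2 (V × Q)), ‖w.fst‖ ≤ ‖w‖ := fun w => WithLp.norm_fst_le _ w
  have hnsnd : ∀ w : (WithLp 2 (V × Q)), ‖w.snd‖ ≤ ‖w‖ := fun w => WithLp.norm_snd_le _ w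
  have hSb : ∀ w : (WithLp 2 (V × Q)), ‖w‖ ≤ (2 * C) * ‖S w‖ := by
    intro w
    have h1 := hb w.fst w.snd
    have h2 : ‖a w.fst + b.flip w.snd‖ ≤ ‖S w‖ := by
      rw [← RV.norm_map]
      exact hnfst (S w)
    have h3 : ‖b w.fst - c w.snd‖ ≤ ‖S w‖ := by
      rw [← RQ.norm_map]
      exact hnsnd (S w)
    have h4 : ‖w‖ ≤ ‖w.fst‖ + ‖w.snd‖ := by
      have := WithLp.prod_norm_sq_eq_of_L2 w
      exact abs_le_of_sq_le_sq' (by nlinarith [norm_nonneg w.fst, norm_nonneg w.snd]) (by positivity) |>.2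
    nlinarith
  have hanti : AntilipschitzWith (2 * C).toNNReal S :=
    AddMonoidHomClass.antilipschitz_of_bound S (fun x => by
      rw [Real.coe_toNNReal _ (by positivity)]; exact hSb x)
  have hScont : Continuous S := by
    refine (WithLp.prod_continuous_toLp 2 V Q).comp ?_
    have h1 : Continuous fun w : (WithLp 2 (V × Q)) => w.fst := WithLp.continuous_fst _ _ _
    have h2 : Continuous fun w : (WithLp 2 (V × Q)) => w.snd := WithLp.continuous_snd _ _ _
    fun_prop
  have hcl : IsClosed (Set.range S) :=
    hanti.isClosed_range (uniformContinuous_addMonoidHom_of_continuous hScont)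
  have : CompleteSpace (LinearMap.range S) := by
    have : IsClosed ((LinearMap.range S : Submodule ℝ (WithLp 2 (V × Q))) : Set (WithLp 2 (V × Q))) := by
      rw [LinearMap.coe_range]; exact hcl
    exact this.completeSpace_coe
  have htop : LinearMap.range S = ⊤ := by
    rw [← Submodule.orthogonal_eq_bot_iff, Submodule.eq_bot_iff]
    intro w hw
    have h0 : S w = 0 := by
      rw [← inner_self_eq_zero (𝕜 := ℝ), hSsym]
      rw [Submodule.mem_orthogonal'] at hw
      exact hw _ ⟨S w, rfl⟩
    have := hSb w
    rw [h0, norm_zero, mul_zero] at this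
    exact norm_le_zero_iff.mp this
  obtain ⟨w, hw⟩ : (WithLp.toLp 2 (RV f, RQ g) : (WithLp 2 (V × Q))) ∈ LinearMap.range S := by rw [htop]; trivial
  refine ⟨w.fst, w.snd, ?_, ?_⟩
  · apply RV.injective
    exact congrArg (fun w : (WithLp 2 (V × Q)) => w.fst) hw
  · apply RQ.injective
    exact congrArg (fun w : (WithLp 2 (V × Q)) => w.snd) hw

section kernelop
variable {X : Type} [NormedAddCommGroup X] [NormedSpace ℝ X]

lemma kop_int {Y : Type} [NormedAddCommGroup Y] [NormedSpace ℝ Y] (μ : Measure ℝ) [IsFiniteMeasure μ] (L : ℝ × ℝ → X →L[ℝ] Y)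
    (hL : StronglyMeasurable L) (C : ℝ) (hC : ∀ z, ‖L z‖ ≤ C) (y : ℝ → X) (hy : Integrable y μ) :
    Integrable (fun z : ℝ × ℝ => L z (y z.2)) (μ.prod μ) := by
  have h1 : Integrable (fun z : ℝ × ℝ => y z.2) (μ.prod μ) := hy.comp_snd μ
  refine Integrable.mono' (h1.norm.const_mul C) ?_ ?_
  · have h2 := hL.aestronglyMeasurable (μ := μ.prod μ)
    exact (ContinuousLinearMap.id ℝ (X →L[ℝ] Y)).aestronglyMeasurable_comp₂ h2 h1.1
  · exact Filter.Eventually.of_forall fun z =>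
      ((L z).le_opNorm _).trans (mul_le_mul_of_nonneg_right (hC z) (norm_nonneg _))

lemma kop_bound (μ : Measure ℝ) [IsFiniteMeasure μ] (L : ℝ × ℝ → X →L[ℝ] X)
    (hL : StronglyMeasurable L) (C : ℝ) (hC : ∀ z, ‖L z‖ ≤ C)
    (hh : ∀ s, ∫ t, ‖L (t, s)‖ ∂μ ≤ 1 / 2) (y : ℝ → X) (hy : Integrable y μ) :
    ∫ t, ‖∫ s, L (t, s) (y s) ∂μ‖ ∂μ ≤ 1 / 2 * ∫ s, ‖y s‖ ∂μ := by
  have hi := kop_int μ L hL C hC y hy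
  calc ∫ t, ‖∫ s, L (t, s) (y s) ∂μ‖ ∂μ ≤ ∫ t, ∫ s, ‖L (t, s) (y s)‖ ∂μ ∂μ :=
        integral_mono hi.integral_prod_left.norm hi.norm.integral_prod_left
          (fun t => norm_integral_le_integral_norm _)
    _ = ∫ s, ∫ t, ‖L (t, s) (y s)‖ ∂μ ∂μ :=
        integral_integral_swap (f := fun t s => ‖L (t, s) (y s)‖) hi.norm
    _ ≤ ∫ s, 1 / 2 * ‖y s‖ ∂μ := by
        refine integral_mono hi.norm.integral_prod_right (hy.norm.const_mul _) (fun s => ?_)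
        have hm : StronglyMeasurable fun t => L (t, s) :=
          hL.comp_measurable (measurable_id.prodMk measurable_const)
        have hiL : Integrable (fun t => ‖L (t, s)‖) μ :=
          (Integrable.of_bound hm.aestronglyMeasurable C
            (Filter.Eventually.of_forall fun t => hC _)).norm
        calc ∫ t, ‖L (t, s) (y s)‖ ∂μ ≤ ∫ t, ‖L (t, s)‖ * ‖y s‖ ∂μ := by
              refine integral_mono_of_nonneg (Filter.Eventually.of_forall fun t => norm_nonneg _)
                (hiL.mul_const _) (Filter.Eventually.of_forall fun t => (L (t, s)).le_opNorm _)
          _ = (∫ t, ‖L (t, s)‖ ∂μ) * ‖y s‖ := integral_mul_const _ _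
          _ ≤ 1 / 2 * ‖y s‖ := mul_le_mul_of_nonneg_right (hh s) (norm_nonneg _)
    _ = _ := integral_const_mul _ _

lemma kop_sub (μ : Measure ℝ) [IsFiniteMeasure μ] (L : ℝ × ℝ → X →L[ℝ] X)
    (hL : StronglyMeasurable L) (C : ℝ) (hC : ∀ z, ‖L z‖ ≤ C) (y y' : ℝ → X)
    (hy : Integrable y μ) (hy' : Integrable y' μ) :
    (fun t => ∫ s, L (t, s) (y s - y' s) ∂μ) =ᵐ[μ]
      fun t => (∫ s, L (t, s) (y s) ∂μ) - ∫ s, L (t, s) (y' s) ∂μ := by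
  filter_upwards [(kop_int μ L hL C hC y hy).prod_right_ae,
    (kop_int μ L hL C hC y' hy').prod_right_ae] with t h1 h2
  simp only [map_sub]
  exact integral_sub h1 h2

lemma kop_fix [CompleteSpace X] (μ : Measure ℝ) [IsFiniteMeasure μ] (L : ℝ × ℝ → X →L[ℝ] X)
    (hL : StronglyMeasurable L) (C : ℝ) (hC : ∀ z, ‖L z‖ ≤ C)
    (hh : ∀ s, ∫ t, ‖L (t, s)‖ ∂μ ≤ 1 / 2) (G : ℝ → X) (hG : Integrable G μ) :
    ∃ y : ℝ → X, Integrable y μ ∧ (∀ᵐ t ∂μ, y t = G t + ∫ s, L (t, s) (y s) ∂μ) ∧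
      (∀ y' : ℝ → X, Integrable y' μ → (∀ᵐ t ∂μ, y' t = G t + ∫ s, L (t, s) (y' s) ∂μ) →
        y' =ᵐ[μ] y) ∧ ∫ t, ‖y t‖ ∂μ ≤ 2 * ∫ t, ‖G t‖ ∂μ := by
  have hK : ∀ y : ℝ → X, Integrable y μ → Integrable (fun t => ∫ s, L (t, s) (y s) ∂μ) μ :=
    fun y hy => (kop_int μ L hL C hC y hy).integral_prod_left
  let Φ : (ℝ →₁[μ] X) → (ℝ →₁[μ] X) := fun y =>
    (hG.add (hK y (L1.integrable_coeFn y))).toL1 _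
  have hΦ : ContractingWith (1 / 2) Φ := by
    refine ⟨by
      rw [← NNReal.coe_lt_coe]; norm_num, ?_⟩
    refine LipschitzWith.of_dist_le_mul fun y y' => ?_
    have hy := L1.integrable_coeFn y
    have hy' := L1.integrable_coeFn y'
    rw [dist_eq_norm, dist_eq_norm]
    simp only [Φ]
    rw [← Integrable.toL1_sub, L1.norm_eq_integral_norm, L1.norm_eq_integral_norm]
    have h1 := kop_bound μ L hL C hC hh _ (hy.sub hy')
    have h2 : ∫ t, ‖(y - y' : ℝ →₁[μ] X) t‖ ∂μ = ∫ t, ‖(y t - y' t)‖ ∂μ := by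
      refine integral_congr_ae ?_
      filter_upwards [Lp.coeFn_sub y y'] with t ht
      rw [ht]; rfl
    rw [h2]
    refine le_trans (le_of_eq ?_) (h1.trans (le_of_eq ?_))
    · refine integral_congr_ae ?_
      filter_upwards [Integrable.coeFn_toL1 ((hG.add (hK y hy)).sub (hG.add (hK y' hy'))),
        kop_sub μ L hL C hC y y' hy hy'] with t h3 h4
      rw [h3]
      simp only [Pi.sub_apply, Pi.add_apply, add_sub_add_left_eq_sub]
      rw [h4]
    · simp
  let y := ContractingWith.fixedPoint Φ hΦ
  have hyf : Φ y = y := hΦ.fixedPoint_isFixedPt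
  have hy : Integrable y μ := L1.integrable_coeFn y
  have hye : ∀ᵐ t ∂μ, y t = G t + ∫ s, L (t, s) (y s) ∂μ := by
    have h1 : (Φ y : ℝ → X) =ᵐ[μ] _ := Integrable.coeFn_toL1 (hG.add (hK y hy))
    rw [hyf] at h1
    exact h1
  refine ⟨y, hy, hye, fun y' hy' hye' => ?_, ?_⟩
  · have h1 := kop_bound μ L hL C hC hh _ (hy'.sub hy)
    have h2 : ∫ t, ‖∫ s, L (t, s) ((y' - (y : ℝ → X)) s) ∂μ‖ ∂μ = ∫ t, ‖(y' - (y : ℝ → X)) t‖ ∂μ := by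
      refine integral_congr_ae ?_
      filter_upwards [hye, hye', kop_sub μ L hL C hC y' y hy' hy] with t h3 h4 h5
      simp only [Pi.sub_apply]
      rw [h5, h3, h4, add_sub_add_left_eq_sub]
    rw [h2] at h1
    have h3 : ∫ t, ‖(y' - (y : ℝ → X)) t‖ ∂μ = 0 :=
      le_antisymm (by linarith) (integral_nonneg fun _ => norm_nonneg _)
    rw [integral_eq_zero_iff_of_nonneg (fun _ => norm_nonneg _) (hy'.sub hy).norm] at h3
    filter_upwards [h3] with t ht
    simpa [sub_eq_zero] using ht
  · have h1 := kop_bound μ L hL C hC hh _ hy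
    have h2 : ∫ t, ‖y t‖ ∂μ ≤ ∫ t, (‖G t‖ + ‖∫ s, L (t, s) (y s) ∂μ‖) ∂μ := by
      refine integral_mono_ae hy.norm (hG.norm.add (hK y hy).norm) ?_
      filter_upwards [hye] with t ht
      rw [ht]
      exact norm_add_le _ _
    rw [integral_add hG.norm (hK y hy).norm] at h2
    linarith

end kernelop

lemma ae_slice (T κ : ℝ) {X Y : Type} [NormedAddCommGroup X] [NormedSpace ℝ X]
    [NormedAddCommGroup Y] [NormedSpace ℝ Y] (K : ℝ × ℝ → X →L[ℝ] Y)
    (hκ : ∀ᵐ ts : ℝ × ℝ ∂volume, 0 ≤ ts.2 → ts.2 ≤ ts.1 → ts.1 ≤ T → ‖K ts‖ ≤ κ) :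
    ∀ᵐ t ∂(volume.restrict (Set.Ioc 0 T)), ∀ᵐ s ∂(volume : Measure ℝ),
      s ∈ Set.Ioc 0 t → ‖K (t, s)‖ ≤ κ := by
  rw [ae_restrict_iff' measurableSet_Ioc]
  rw [Measure.volume_eq_prod] at hκ
  filter_upwards [Measure.ae_ae_of_ae_prod hκ] with t ht htT
  filter_upwards [ht] with s hs hst
  exact hs hst.1.le hst.2 htT.2

lemma ae_slice_int (T κ : ℝ) {X Y : Type} [NormedAddCommGroup X] [NormedSpace ℝ X]
    [NormedAddCommGroup Y] [NormedSpace ℝ Y] (K : ℝ × ℝ → X →L[ℝ] Y) (hK : StronglyMeasurable K)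
    (hκ : ∀ᵐ ts : ℝ × ℝ ∂volume, 0 ≤ ts.2 → ts.2 ≤ ts.1 → ts.1 ≤ T → ‖K ts‖ ≤ κ)
    (x : ℝ → X) (hx : Integrable x (volume.restrict (Set.Ioc 0 T))) :
    ∀ᵐ t ∂(volume.restrict (Set.Ioc 0 T)),
      IntervalIntegrable (fun s => K (t, s) (x s)) volume 0 t := by
  filter_upwards [ae_slice T κ K hκ, ae_restrict_mem measurableSet_Ioc] with t h1 ht
  rw [intervalIntegrable_iff_integrableOn_Ioc_of_le ht.1.le]
  have hx' : IntegrableOn x (Set.Ioc 0 t) :=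
    IntegrableOn.mono_set hx (Set.Ioc_subset_Ioc_right ht.2)
  have hm : StronglyMeasurable fun s => K (t, s) :=
    hK.comp_measurable (measurable_const.prodMk measurable_id)
  refine Integrable.mono' (hx'.norm.const_mul κ) ?_ ?_
  · exact (ContinuousLinearMap.id ℝ (X →L[ℝ] Y)).aestronglyMeasurable_comp₂
      hm.aestronglyMeasurable hx'.1
  · rw [ae_restrict_iff' measurableSet_Ioc]
    filter_upwards [h1] with s hs hst
    exact ((K (t, s)).le_opNorm _).trans (mul_le_mul_of_nonneg_right (hs hst) (norm_nonneg _))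

lemma volterra {X : Type} [NormedAddCommGroup X] [NormedSpace ℝ X] [CompleteSpace X]
    (T κ : ℝ) (hκ0 : 0 ≤ κ) (K : ℝ × ℝ → X →L[ℝ] X) (hK : StronglyMeasurable K)
    (hκ : ∀ᵐ ts : ℝ × ℝ ∂volume, 0 ≤ ts.2 → ts.2 ≤ ts.1 → ts.1 ≤ T → ‖K ts‖ ≤ κ)
    (G : ℝ → X) (hG : Integrable G (volume.restrict (Set.Ioc 0 T))) :
    ∃ x : ℝ → X, Integrable x (volume.restrict (Set.Ioc 0 T)) ∧
      (∀ᵐ t ∂(volume.restrict (Set.Ioc 0 T)), x t = G t + ∫ s in (0:ℝ)..t, K (t, s) (x s)) ∧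
      (∀ x' : ℝ → X, Integrable x' (volume.restrict (Set.Ioc 0 T)) →
        (∀ᵐ t ∂(volume.restrict (Set.Ioc 0 T)), x' t = G t + ∫ s in (0:ℝ)..t, K (t, s) (x' s)) →
        x' =ᵐ[volume.restrict (Set.Ioc 0 T)] x) ∧
      ∫ t in Set.Ioc 0 T, ‖x t‖ ≤
        2 * Real.exp ((2 * κ + 1) * T) * ∫ t in Set.Ioc 0 T, ‖G t‖ := by
  classical
  set μ := (volume : Measure ℝ).restrict (Set.Ioc 0 T) with hμ
  set l := 2 * κ + 1 with hl
  have hl0 : 0 < l := by positivity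
  let A : Set (ℝ × ℝ) := {z | 0 < z.2 ∧ z.2 ≤ z.1 ∧ ‖K z‖ ≤ κ}
  have hA : MeasurableSet A := by
    refine (measurableSet_lt measurable_const measurable_snd).inter
      ((measurableSet_le measurable_snd measurable_fst).inter
        (measurableSet_le hK.norm.measurable measurable_const))
  let L : ℝ × ℝ → X →L[ℝ] X := A.indicator fun z => Real.exp (-l * (z.1 - z.2)) • K z
  have hL : StronglyMeasurable L := by
    have h1 : StronglyMeasurable fun z : ℝ × ℝ => Real.exp (-l * (z.1 - z.2)) :=
      Continuous.stronglyMeasurable (by fun_prop)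
    exact (h1.smul hK).indicator hA
  have hLb : ∀ z, ‖L z‖ ≤ (Set.Ici z.2).indicator (fun t => κ * Real.exp (-l * (t - z.2))) z.1 := by
    intro z
    by_cases hz : z ∈ A
    · have h1 : z.1 ∈ Set.Ici z.2 := hz.2.1
      simp only [L]
      rw [Set.indicator_of_mem hz, Set.indicator_of_mem h1, norm_smul, Real.norm_eq_abs,
        Real.abs_exp, mul_comm]
      exact mul_le_mul_of_nonneg_right hz.2.2 (Real.exp_pos _).le
    · simp only [L]
      rw [Set.indicator_of_notMem hz, norm_zero]
      exact Set.indicator_nonneg (fun _ _ => by positivity) _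
  have hLC : ∀ z, ‖L z‖ ≤ κ := by
    intro z
    refine (hLb z).trans ?_
    by_cases h1 : z.1 ∈ Set.Ici z.2
    · rw [Set.indicator_of_mem h1]
      have : Real.exp (-l * (z.1 - z.2)) ≤ 1 := by
        rw [Real.exp_le_one_iff]
        have : z.2 ≤ z.1 := h1
        nlinarith
      nlinarith
    · rw [Set.indicator_of_notMem h1]; exact hκ0
  have hLint : ∀ s, ∫ t, ‖L (t, s)‖ ∂μ ≤ 1 / 2 := by
    intro s
    have he : ∀ t, κ * Real.exp (-l * (t - s)) = κ * Real.exp (l * s) * Real.exp (-l * t) := by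
      intro t
      rw [mul_assoc, ← Real.exp_add]; congr 2; ring
    have hi1 : IntegrableOn (fun t => κ * Real.exp (-l * (t - s))) (Set.Ici s) := by
      rw [integrableOn_Ici_iff_integrableOn_Ioi]
      simp only [he]
      exact (integrableOn_exp_mul_Ioi (by linarith) s).const_mul _
    have hi2 : Integrable ((Set.Ici s).indicator (fun t => κ * Real.exp (-l * (t - s)))) :=
      (integrable_indicator_iff measurableSet_Ici).mpr hi1
    calc ∫ t, ‖L (t, s)‖ ∂μ
        ≤ ∫ t, (Set.Ici s).indicator (fun t => κ * Real.exp (-l * (t - s))) t ∂μ :=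
          integral_mono_of_nonneg (Filter.Eventually.of_forall fun t => norm_nonneg _)
            hi2.restrict (Filter.Eventually.of_forall fun t => hLb (t, s))
      _ ≤ ∫ t, (Set.Ici s).indicator (fun t => κ * Real.exp (-l * (t - s))) t :=
          setIntegral_le_integral hi2 (Filter.Eventually.of_forall fun t =>
            Set.indicator_nonneg (fun _ _ => by positivity) _)
      _ = κ / l := by
          rw [integral_indicator measurableSet_Ici, integral_Ici_eq_integral_Ioi]
          simp only [he]
          rw [integral_const_mul, integral_exp_mul_Ioi (by linarith)]
          have : Real.exp (l * s) * Real.exp (-l * s) = 1 := by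
            rw [← Real.exp_add]; simp
          rw [neg_mul] at this ⊢
          field_simp
          linear_combination κ * this
      _ ≤ 1 / 2 := by rw [div_le_div_iff₀ hl0 (by norm_num)]; linarith
  have hconv : ∀ᵐ t ∂μ, ∀ y : ℝ → X, ∫ s, L (t, s) (y s) ∂μ =
      Real.exp (-l * t) • ∫ s in (0:ℝ)..t, K (t, s) (Real.exp (l * s) • y s) := by
    filter_upwards [ae_slice T κ K hκ, ae_restrict_mem measurableSet_Ioc] with t h1 ht y
    rw [intervalIntegral.integral_of_le ht.1.le, ← integral_smul,
      ← integral_indicator measurableSet_Ioc, ← integral_indicator measurableSet_Ioc]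
    refine integral_congr_ae ?_
    filter_upwards [h1] with s hs
    by_cases h2 : s ∈ Set.Ioc 0 t
    · have h3 : s ∈ Set.Ioc 0 T := ⟨h2.1, h2.2.trans ht.2⟩
      have h4 : (t, s) ∈ A := ⟨h2.1, h2.2, hs h2⟩
      rw [Set.indicator_of_mem h2, Set.indicator_of_mem h3]
      simp only [L]
      rw [Set.indicator_of_mem h4, map_smul, smul_smul, ← Real.exp_add, smul_apply]
      congr 2; ring
    · rw [Set.indicator_of_notMem h2]
      have h4 : (t, s) ∉ A := fun h => h2 ⟨h.1, h.2.1⟩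
      simp only [Set.indicator_apply_eq_zero, L]
      intro _
      rw [Set.indicator_of_notMem h4]; simp
  have hscale : ∀ (r : ℝ) (y : ℝ → X), Integrable y μ →
      Integrable (fun t => Real.exp (r * t) • y t) μ := by
    intro r y hy
    refine Integrable.mono' (hy.norm.const_mul (Real.exp (|r| * T))) ?_ ?_
    · exact AEStronglyMeasurable.smul
        (Continuous.aestronglyMeasurable (by fun_prop)) hy.1
    · filter_upwards [ae_restrict_mem measurableSet_Ioc] with t ht
      rw [norm_smul, Real.norm_eq_abs, Real.abs_exp]
      refine mul_le_mul_of_nonneg_right (Real.exp_le_exp.mpr ?_) (norm_nonneg _)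
      have := le_abs_self r
      have := abs_nonneg r
      nlinarith [ht.1, ht.2]
  have hexp : ∀ (t : ℝ) (v : X), Real.exp (l * t) • Real.exp (-l * t) • v = v := by
    intro t v
    rw [smul_smul, ← Real.exp_add]; simp
  have hexp' : ∀ (t : ℝ) (v : X), Real.exp (-l * t) • Real.exp (l * t) • v = v := by
    intro t v
    rw [smul_smul, ← Real.exp_add]; simp
  obtain ⟨y, hy, hye, hyu, hyb⟩ := kop_fix μ L hL κ hLC hLint _ (hscale (-l) G hG)
  have hx := hscale l y hy
  refine ⟨fun t => Real.exp (l * t) • y t, hx, ?_, ?_, ?_⟩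
  · filter_upwards [hye, hconv] with t h1 h2
    rw [h1, h2, smul_add, hexp, hexp]
  · intro x' hx' hxe'
    have := hyu (fun t => Real.exp (-l * t) • x' t) (hscale _ _ hx') (by
      filter_upwards [hxe', hconv] with t h1 h2
      rw [h2]
      simp only [hexp]
      rw [← smul_add, ← h1])
    filter_upwards [this] with t ht
    rw [← ht, hexp]
  · have h1 : ∫ t, ‖Real.exp (l * t) • y t‖ ∂μ ≤ ∫ t, Real.exp (l * T) * ‖y t‖ ∂μ := by
      refine integral_mono_ae hx.norm (hy.norm.const_mul _) ?_
      filter_upwards [ae_restrict_mem measurableSet_Ioc] with t ht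
      rw [norm_smul, Real.norm_eq_abs, Real.abs_exp]
      refine mul_le_mul_of_nonneg_right (Real.exp_le_exp.mpr ?_) (norm_nonneg _)
      nlinarith [ht.2]
    have h2 : ∫ t, ‖Real.exp (-l * t) • G t‖ ∂μ ≤ ∫ t, ‖G t‖ ∂μ := by
      refine integral_mono_ae (hscale _ _ hG).norm hG.norm ?_
      filter_upwards [ae_restrict_mem measurableSet_Ioc] with t ht
      rw [norm_smul, Real.norm_eq_abs, Real.abs_exp]
      have : Real.exp (-l * t) ≤ 1 := by
        rw [Real.exp_le_one_iff]; nlinarith [ht.1]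
      nlinarith [norm_nonneg (G t)]
    rw [integral_const_mul] at h1
    refine h1.trans ?_
    have := Real.exp_pos (l * T)
    nlinarith

lemma static_inv {V Q : Type} [NormedAddCommGroup V] [InnerProductSpace ℝ V] [CompleteSpace V]
    [NormedAddCommGroup Q] [InnerProductSpace ℝ Q] [CompleteSpace Q]
    (a : V →L[ℝ] V →L[ℝ] ℝ) (b : V →L[ℝ] Q →L[ℝ] ℝ) (c : Q →L[ℝ] Q →L[ℝ] ℝ)
    (has : ∀ v w, a v w = a w v) (hcs : ∀ v w, c v w = c w v) (C : ℝ) (hC : 0 ≤ C)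
    (hb : ∀ u p, ‖u‖ + ‖p‖ ≤ C * (‖a u + b.flip p‖ + ‖b u - c p‖)) :
    ∃ R : ((V →L[ℝ] ℝ) × (Q →L[ℝ] ℝ)) →L[ℝ] (V × Q), (∀ y, ‖R y‖ ≤ C * (‖y.1‖ + ‖y.2‖)) ∧
      ∀ x y, x = R y ↔ a x.1 + b.flip x.2 = y.1 ∧ b x.1 - c x.2 = y.2 := by
  let M : (V × Q) →ₗ[ℝ] ((V →L[ℝ] ℝ) × (Q →L[ℝ] ℝ)) :=
    ((a ∘L ContinuousLinearMap.fst ℝ V Q + b.flip ∘L ContinuousLinearMap.snd ℝ V Q).prod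
      (b ∘L ContinuousLinearMap.fst ℝ V Q - c ∘L ContinuousLinearMap.snd ℝ V Q) :
      (V × Q) →L[ℝ] ((V →L[ℝ] ℝ) × (Q →L[ℝ] ℝ)))
  have hM : ∀ x, M x = (a x.1 + b.flip x.2, b x.1 - c x.2) := fun x => rfl
  have hinj : Function.Injective M := by
    rw [injective_iff_map_eq_zero]
    intro x hx
    rw [hM, Prod.mk_eq_zero] at hx
    have := hb x.1 x.2
    rw [hx.1, hx.2] at this
    simp only [norm_zero, add_zero, mul_zero] at this
    have h1 := norm_nonneg x.1
    have h2 := norm_nonneg x.2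
    exact Prod.ext (norm_le_zero_iff.mp (by linarith)) (norm_le_zero_iff.mp (by linarith))
  have hsurj : Function.Surjective M := by
    intro y
    obtain ⟨u, p, h1, h2⟩ := static_surj a b c has hcs C hC hb y.1 y.2
    exact ⟨(u, p), by rw [hM]; exact Prod.ext h1 h2⟩
  let e := LinearEquiv.ofBijective M ⟨hinj, hsurj⟩
  have he : ∀ x, e x = M x := fun x => rfl
  have hbd : ∀ y, ‖e.symm y‖ ≤ C * (‖y.1‖ + ‖y.2‖) := by
    intro y
    have h1 := hb (e.symm y).1 (e.symm y).2
    have h2 : M (e.symm y) = y := by rw [← he, e.apply_symm_apply]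
    rw [hM] at h2
    rw [show a (e.symm y).1 + b.flip (e.symm y).2 = y.1 from congrArg Prod.fst h2,
      show b (e.symm y).1 - c (e.symm y).2 = y.2 from congrArg Prod.snd h2] at h1
    refine le_trans ?_ h1
    rw [Prod.norm_def]
    exact max_le (by linarith [norm_nonneg (e.symm y).2]) (by linarith [norm_nonneg (e.symm y).1])
  refine ⟨LinearMap.mkContinuous e.symm.toLinearMap (C * 2) (fun y => ?_), hbd, fun x y => ?_⟩
  · refine (hbd y).trans ?_
    have h1 := norm_fst_le y
    have h2 := norm_snd_le y
    rw [mul_assoc]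
    exact mul_le_mul_of_nonneg_left (by linarith) hC
  · rw [LinearMap.mkContinuous_apply, LinearEquiv.coe_coe, LinearEquiv.eq_symm_apply, he, hM,
      Prod.ext_iff]

lemma op_bounds {V Q Z W : Type} [NormedAddCommGroup V] [NormedSpace ℝ V]
    [NormedAddCommGroup Q] [NormedSpace ℝ Q] [NormedAddCommGroup Z] [NormedSpace ℝ Z]
    [NormedAddCommGroup W] [NormedSpace ℝ W] (P : V × Q →L[ℝ] Z × W) (N k Ck : ℝ) (hN : 0 ≤ N)
    (h : ∀ x, ‖P x‖ ≤ N * ‖x‖) (hk : |k| ≤ Ck) : ‖k • P‖ ≤ Ck * N := by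
  rw [norm_smul]
  exact mul_le_mul hk (P.opNorm_le_bound hN h) (norm_nonneg _) ((abs_nonneg _).trans hk)

lemma integral_prod_apply_fst {V Q : Type} [NormedAddCommGroup V] [NormedSpace ℝ V]
    [NormedAddCommGroup Q] [NormedSpace ℝ Q] (F : ℝ → (V →L[ℝ] ℝ) × (Q →L[ℝ] ℝ)) (t : ℝ)
    (hF : IntervalIntegrable F volume 0 t) (v : V) :
    (∫ s in (0:ℝ)..t, F s).1 v = ∫ s in (0:ℝ)..t, (F s).1 v :=
  (((ContinuousLinearMap.apply ℝ ℝ v) ∘L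
    (ContinuousLinearMap.fst ℝ (V →L[ℝ] ℝ) (Q →L[ℝ] ℝ))).intervalIntegral_comp_comm hF).symm

lemma integral_prod_apply_snd {V Q : Type} [NormedAddCommGroup V] [NormedSpace ℝ V]
    [NormedAddCommGroup Q] [NormedSpace ℝ Q] (F : ℝ → (V →L[ℝ] ℝ) × (Q →L[ℝ] ℝ)) (t : ℝ)
    (hF : IntervalIntegrable F volume 0 t) (v : Q) :
    (∫ s in (0:ℝ)..t, F s).2 v = ∫ s in (0:ℝ)..t, (F s).2 v :=
  (((ContinuousLinearMap.apply ℝ ℝ v) ∘L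
    (ContinuousLinearMap.snd ℝ (V →L[ℝ] ℝ) (Q →L[ℝ] ℝ))).intervalIntegral_comp_comm hF).symm

lemma comb_meas {X Y : Type} [NormedAddCommGroup X] [NormedSpace ℝ X]
    [NormedAddCommGroup Y] [NormedSpace ℝ Y] (P1 P2 P3 P4 : X →L[ℝ] Y) (e1 e2 e3 e4 : ℝ × ℝ → ℝ)
    (h1 : Measurable e1) (h2 : Measurable e2) (h3 : Measurable e3) (h4 : Measurable e4) :
    StronglyMeasurable fun z => e1 z • P1 + e2 z • P2 + e3 z • P3 - e4 z • P4 :=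
  (((h1.stronglyMeasurable.smul_const P1).add (h2.stronglyMeasurable.smul_const P2)).add
    (h3.stronglyMeasurable.smul_const P3)).sub (h4.stronglyMeasurable.smul_const P4)

lemma comb_bound {X Y : Type} [NormedAddCommGroup X] [NormedSpace ℝ X]
    [NormedAddCommGroup Y] [NormedSpace ℝ Y] (P1 P2 P3 P4 : X →L[ℝ] Y) (c1 c2 c3 c4 : ℝ)
    (h1 : ‖P1‖ ≤ c1) (h2 : ‖P2‖ ≤ c2) (h3 : ‖P3‖ ≤ c3) (h4 : ‖P4‖ ≤ c4) :
    ‖P1 + P2 + P3 - P4‖ ≤ c1 + c2 + c3 + c4 :=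
  (norm_sub_le _ _).trans (add_le_add
    (norm_add₃_le.trans (add_le_add (add_le_add h1 h2) h3)) h4)

lemma comb_apply {X Y : Type} [NormedAddCommGroup X] [NormedSpace ℝ X]
    [NormedAddCommGroup Y] [NormedSpace ℝ Y] (P1 P2 P3 P4 : X →L[ℝ] Y) (c1 c2 c3 c4 : ℝ) (x : X) :
    (c1 • P1 + c2 • P2 + c3 • P3 - c4 • P4) x =
      c1 • P1 x + c2 • P2 x + c3 • P3 x - c4 • P4 x := rfl

/-- If `Im B` is closed and the inf-sup condition with constant
`β > 0` holds, then for every `f ∈ L¹(J;V')`, `g ∈ L¹(J;Q')` Problem (P) has exactly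
one solution (unique up to a.e. equality on `J`) and there is a constant `C > 0`
depending only on `α₀, β, γ₀, ‖a‖, ‖b‖, ‖c‖, C_{k₁},…,C_{k₄}, T` — uniformly over all
spaces, forms, kernels and data satisfying these bounds — such that
`‖u‖_{L¹(J;V)} + ‖p‖_{L¹(J;Q)} ≤ C (‖f‖_{L¹(J;V')} + ‖g‖_{L¹(J;Q')})`. -/
theorem statement0
    (α₀ β γ₀ Na Nb Nc Ck1 Ck2 Ck3 Ck4 T : ℝ)
    (hα₀ : 0 < α₀) (hβ : 0 < β) (hγ₀ : 0 < γ₀) (hT : 0 < T)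
    (hNa : 0 ≤ Na) (hNb : 0 ≤ Nb) (hNc : 0 ≤ Nc)
    (hCk1 : 0 ≤ Ck1) (hCk2 : 0 ≤ Ck2) (hCk3 : 0 ≤ Ck3) (hCk4 : 0 ≤ Ck4) :
    ∃ C : ℝ, 0 < C ∧
      ∀ (V Q : Type)
        [NormedAddCommGroup V] [InnerProductSpace ℝ V] [CompleteSpace V]
        [NormedAddCommGroup Q] [InnerProductSpace ℝ Q] [CompleteSpace Q]
        (a : V →L[ℝ] V →L[ℝ] ℝ) (b : V →L[ℝ] Q →L[ℝ] ℝ) (c : Q →L[ℝ] Q →L[ℝ] ℝ)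
        (k₁ k₂ k₃ k₄ : ℝ → ℝ → ℝ) (f : ℝ → V →L[ℝ] ℝ) (g : ℝ → Q →L[ℝ] ℝ),
        (∀ v w : V, a v w = a w v) → (∀ v : V, 0 ≤ a v v) →
        (∀ q r : Q, c q r = c r q) → (∀ q : Q, 0 ≤ c q q) →
        ‖a‖ ≤ Na → ‖b‖ ≤ Nb → ‖c‖ ≤ Nc →
        (∀ v ∈ LinearMap.ker (b : V →ₗ[ℝ] Q →L[ℝ] ℝ), α₀ * ‖v‖ ^ 2 ≤ a v v) →
        (∀ q ∈ LinearMap.ker (b.flip : Q →ₗ[ℝ] V →L[ℝ] ℝ), γ₀ * ‖q‖ ^ 2 ≤ c q q) →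
        IsClosed (Set.range fun v : V => (b v : Q →L[ℝ] ℝ)) →
        (∀ q ∈ (LinearMap.ker (b.flip : Q →ₗ[ℝ] V →L[ℝ] ℝ))ᗮ, β * ‖q‖ ≤ ‖b.flip q‖) →
        (∀ v ∈ (LinearMap.ker (b : V →ₗ[ℝ] Q →L[ℝ] ℝ))ᗮ, β * ‖v‖ ≤ ‖b v‖) →
        Measurable (Function.uncurry k₁) → Measurable (Function.uncurry k₂) →
        Measurable (Function.uncurry k₃) → Measurable (Function.uncurry k₄) →
        (∀ᵐ ts : ℝ × ℝ ∂volume,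
          0 ≤ ts.2 → ts.2 ≤ ts.1 → ts.1 ≤ T → |k₁ ts.1 ts.2| ≤ Ck1) →
        (∀ᵐ ts : ℝ × ℝ ∂volume,
          0 ≤ ts.2 → ts.2 ≤ ts.1 → ts.1 ≤ T → |k₂ ts.1 ts.2| ≤ Ck2) →
        (∀ᵐ ts : ℝ × ℝ ∂volume,
          0 ≤ ts.2 → ts.2 ≤ ts.1 → ts.1 ≤ T → |k₃ ts.1 ts.2| ≤ Ck3) →
        (∀ᵐ ts : ℝ × ℝ ∂volume,
          0 ≤ ts.2 → ts.2 ≤ ts.1 → ts.1 ≤ T → |k₄ ts.1 ts.2| ≤ Ck4) →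
        IntervalIntegrable f volume 0 T → IntervalIntegrable g volume 0 T →
        ∃ (u : ℝ → V) (p : ℝ → Q),
          IntervalIntegrable u volume 0 T ∧ IntervalIntegrable p volume 0 T ∧
          SolvesP V Q T a b c k₁ k₂ k₃ k₄ f g u p ∧
          (∀ (u' : ℝ → V) (p' : ℝ → Q),
            IntervalIntegrable u' volume 0 T → IntervalIntegrable p' volume 0 T →
            SolvesP V Q T a b c k₁ k₂ k₃ k₄ f g u' p' →
            ∀ᵐ t ∂volume, t ∈ Set.Icc (0:ℝ) T → u' t = u t ∧ p' t = p t) ∧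
          (∫ t in (0:ℝ)..T, ‖u t‖) + (∫ t in (0:ℝ)..T, ‖p t‖)
            ≤ C * ((∫ t in (0:ℝ)..T, ‖f t‖) + ∫ t in (0:ℝ)..T, ‖g t‖) := by
  have hD0 : 0 ≤ statD α₀ β γ₀ Na Nc := by unfold statD; positivity
  obtain ⟨C0, hC0e⟩ : ∃ C0, C0 = statD α₀ β γ₀ Na Nc + 1 := ⟨_, rfl⟩
  have hC0 : 0 < C0 := by rw [hC0e]; linarith
  obtain ⟨κ0, hκ0e⟩ : ∃ κ0, κ0 = Ck1 * Na + Ck2 * Nb + Ck3 * Nb + Ck4 * Nc := ⟨_, rfl⟩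
  have hκ0 : 0 ≤ κ0 := by rw [hκ0e]; positivity
  obtain ⟨κ, hκe⟩ : ∃ κ, κ = 2 * C0 * κ0 := ⟨_, rfl⟩
  have hκ : 0 ≤ κ := by rw [hκe]; positivity
  refine ⟨2 * (2 * Real.exp ((2 * κ + 1) * T) * C0), by positivity, ?_⟩
  intro V Q _ _ _ _ _ _ a b c k₁ k₂ k₃ k₄ f g has hap hcs hcp ha hb hc hK hH _ hi' hi
    hm1 hm2 hm3 hm4 hk1 hk2 hk3 hk4 hf hg
  have hst : ∀ u p, ‖u‖ + ‖p‖ ≤ C0 * (‖a u + b.flip p‖ + ‖b u - c p‖) := fun u p => by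
    rw [hC0e]
    exact static_bound a b c α₀ β γ₀ Na Nc hα₀ hβ hγ₀ hNa hNc has hap hcs hcp ha hc hK hH hi' hi u p
  obtain ⟨R, hRb, hR⟩ := static_inv a b c has hcs C0 hC0.le hst
  rw [intervalIntegrable_iff_integrableOn_Ioc_of_le hT.le] at hf hg
  let P1 : (V × Q) →L[ℝ] ((V →L[ℝ] ℝ) × (Q →L[ℝ] ℝ)) :=
    (a ∘L ContinuousLinearMap.fst ℝ V Q).prod 0
  let P2 : (V × Q) →L[ℝ] ((V →L[ℝ] ℝ) × (Q →L[ℝ] ℝ)) :=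
    (b.flip ∘L ContinuousLinearMap.snd ℝ V Q).prod 0
  let P3 : (V × Q) →L[ℝ] ((V →L[ℝ] ℝ) × (Q →L[ℝ] ℝ)) :=
    ContinuousLinearMap.prod 0 (b ∘L ContinuousLinearMap.fst ℝ V Q)
  let P4 : (V × Q) →L[ℝ] ((V →L[ℝ] ℝ) × (Q →L[ℝ] ℝ)) :=
    ContinuousLinearMap.prod 0 (c ∘L ContinuousLinearMap.snd ℝ V Q)
  let N : ℝ × ℝ → (V × Q) →L[ℝ] ((V →L[ℝ] ℝ) × (Q →L[ℝ] ℝ)) := fun z =>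
    k₁ z.1 z.2 • P1 + k₂ z.1 z.2 • P2 + k₃ z.1 z.2 • P3 - k₄ z.1 z.2 • P4
  have hP1 : ∀ x, ‖P1 x‖ ≤ Na * ‖x‖ := fun x => by
    have h : ‖P1 x‖ = ‖a x.1‖ := by simp [P1, Prod.norm_def]
    rw [h]
    exact (a.le_opNorm _).trans (mul_le_mul ha (norm_fst_le x) (norm_nonneg _) hNa)
  have hP2 : ∀ x, ‖P2 x‖ ≤ Nb * ‖x‖ := fun x => by
    have h : ‖P2 x‖ = ‖b.flip x.2‖ := by simp [P2, Prod.norm_def]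
    rw [h]
    refine (b.flip.le_opNorm _).trans (mul_le_mul ?_ (norm_snd_le x) (norm_nonneg _) hNb)
    rw [ContinuousLinearMap.opNorm_flip]; exact hb
  have hP3 : ∀ x, ‖P3 x‖ ≤ Nb * ‖x‖ := fun x => by
    have h : ‖P3 x‖ = ‖b x.1‖ := by simp [P3, Prod.norm_def]
    rw [h]
    exact (b.le_opNorm _).trans (mul_le_mul hb (norm_fst_le x) (norm_nonneg _) hNb)
  have hP4 : ∀ x, ‖P4 x‖ ≤ Nc * ‖x‖ := fun x => by
    have h : ‖P4 x‖ = ‖c x.2‖ := by simp [P4, Prod.norm_def]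
    rw [h]
    exact (c.le_opNorm _).trans (mul_le_mul hc (norm_snd_le x) (norm_nonneg _) hNc)
  have hNm : StronglyMeasurable N := comb_meas P1 P2 P3 P4 _ _ _ _ hm1 hm2 hm3 hm4
  have hN1 : ∀ z u p v, (N z (u, p)).1 v = k₁ z.1 z.2 * a u v + k₂ z.1 z.2 * b v p := by
    intro z u p v
    simp only [N]
    rw [comb_apply]
    simp [P1, P2, P3, P4]
  have hN2 : ∀ z u p q, (N z (u, p)).2 q = k₃ z.1 z.2 * b u q - k₄ z.1 z.2 * c p q := by
    intro z u p v
    simp only [N]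
    rw [comb_apply]
    simp [P1, P2, P3, P4]
  have hNb' : ∀ᵐ ts : ℝ × ℝ ∂volume, 0 ≤ ts.2 → ts.2 ≤ ts.1 → ts.1 ≤ T → ‖N ts‖ ≤ κ0 := by
    filter_upwards [hk1, hk2, hk3, hk4] with z h1 h2 h3 h4 i1 i2 i3
    have j1 := op_bounds P1 Na _ Ck1 hNa hP1 (h1 i1 i2 i3)
    have j2 := op_bounds P2 Nb _ Ck2 hNb hP2 (h2 i1 i2 i3)
    have j3 := op_bounds P3 Nb _ Ck3 hNb hP3 (h3 i1 i2 i3)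
    have j4 := op_bounds P4 Nc _ Ck4 hNc hP4 (h4 i1 i2 i3)
    rw [hκ0e]
    exact comb_bound _ _ _ _ _ _ _ _ j1 j2 j3 j4
  have hRn : ‖R‖ ≤ 2 * C0 := R.opNorm_le_bound (by positivity) fun y => by
    refine (hRb y).trans ?_
    have h1 := norm_fst_le y
    have h2 := norm_snd_le y
    nlinarith
  have hKm : StronglyMeasurable fun z => R ∘L N z :=
    (ContinuousLinearMap.compL ℝ (V × Q) ((V →L[ℝ] ℝ) × (Q →L[ℝ] ℝ)) (V × Q) R).continuous.comp_stronglyMeasurable hNm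
  have hKb : ∀ᵐ ts : ℝ × ℝ ∂volume, 0 ≤ ts.2 → ts.2 ≤ ts.1 → ts.1 ≤ T → ‖R ∘L N ts‖ ≤ κ := by
    filter_upwards [hNb'] with z h1 i1 i2 i3
    rw [hκe]
    exact (R.opNorm_comp_le _).trans (mul_le_mul hRn (h1 i1 i2 i3) (norm_nonneg _) (by positivity))
  have hfg : Integrable (fun t => (f t, g t)) (volume.restrict (Set.Ioc 0 T)) := hf.prodMk hg
  have hG : Integrable (fun t => R (f t, g t)) (volume.restrict (Set.Ioc 0 T)) :=
    R.integrable_comp hfg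
  have hequiv : ∀ (u : ℝ → V) (p : ℝ → Q), Integrable u (volume.restrict (Set.Ioc 0 T)) →
      Integrable p (volume.restrict (Set.Ioc 0 T)) →
      (SolvesP V Q T a b c k₁ k₂ k₃ k₄ f g u p ↔
        ∀ᵐ t ∂(volume.restrict (Set.Ioc 0 T)), (u t, p t) =
          R (f t, g t) + ∫ s in (0:ℝ)..t, (R ∘L N (t, s)) (u s, p s)) := by
    intro u p hu hp
    have hint := ae_slice_int T κ0 N hNm hNb' (fun s => (u s, p s)) (hu.prodMk hp)
    have hpt : ∀ᵐ t ∂(volume.restrict (Set.Ioc 0 T)),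
        (((∀ v : V, a (u t) v + b v (p t)
            = f t v + ∫ s in (0:ℝ)..t, (k₁ t s * a (u s) v + k₂ t s * b v (p s))) ∧
          (∀ q : Q, b (u t) q - c (p t) q
            = g t q + ∫ s in (0:ℝ)..t, (k₃ t s * b (u s) q - k₄ t s * c (p s) q))) ↔
        (u t, p t) = R (f t, g t) + ∫ s in (0:ℝ)..t, (R ∘L N (t, s)) (u s, p s)) := by
      filter_upwards [hint] with t ht
      have e1 : ∫ s in (0:ℝ)..t, (R ∘L N (t, s)) (u s, p s) =
          R (∫ s in (0:ℝ)..t, N (t, s) (u s, p s)) := R.intervalIntegral_comp_comm ht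
      rw [e1, ← map_add, hR]
      refine and_congr ?_ ?_
      · rw [ContinuousLinearMap.ext_iff]
        refine forall_congr' fun v => ?_
        rw [Prod.fst_add, add_apply, add_apply, integral_prod_apply_fst _ _ ht]
        simp only [hN1, ContinuousLinearMap.flip_apply]
      · rw [ContinuousLinearMap.ext_iff]
        refine forall_congr' fun v => ?_
        rw [Prod.snd_add, add_apply, sub_apply, integral_prod_apply_snd _ _ ht]
        simp only [hN2]
    unfold SolvesP
    rw [← ae_restrict_iff' measurableSet_Icc, ← restrict_Ioc_eq_restrict_Icc]
    exact Filter.eventually_congr hpt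
  obtain ⟨x, hx, hxe, hxu, hxb⟩ := volterra T κ hκ (fun z => R ∘L N z) hKm hKb _ hG
  have hu : Integrable (fun t => (x t).1) (volume.restrict (Set.Ioc 0 T)) := hx.fst
  have hp : Integrable (fun t => (x t).2) (volume.restrict (Set.Ioc 0 T)) := hx.snd
  refine ⟨fun t => (x t).1, fun t => (x t).2, ?_, ?_, ?_, ?_, ?_⟩
  · rw [intervalIntegrable_iff_integrableOn_Ioc_of_le hT.le]; exact hu
  · rw [intervalIntegrable_iff_integrableOn_Ioc_of_le hT.le]; exact hp
  · exact (hequiv _ _ hu hp).mpr hxe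
  · intro u' p' hu' hp' hs'
    rw [intervalIntegrable_iff_integrableOn_Ioc_of_le hT.le] at hu' hp'
    have h1 := hxu (fun t => (u' t, p' t)) (hu'.prodMk hp') ((hequiv _ _ hu' hp').mp hs')
    rw [← ae_restrict_iff' measurableSet_Icc, ← restrict_Ioc_eq_restrict_Icc]
    filter_upwards [h1] with t ht
    rw [← ht]
    exact ⟨rfl, rfl⟩
  · simp only [intervalIntegral.integral_of_le hT.le]
    have h1 : ∫ t in Set.Ioc 0 T, ‖(x t).1‖ ≤ ∫ t in Set.Ioc 0 T, ‖x t‖ :=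
      integral_mono hu.norm hx.norm fun t => norm_fst_le _
    have h2 : ∫ t in Set.Ioc 0 T, ‖(x t).2‖ ≤ ∫ t in Set.Ioc 0 T, ‖x t‖ :=
      integral_mono hp.norm hx.norm fun t => norm_snd_le _
    have h3 : ∫ t in Set.Ioc 0 T, ‖R (f t, g t)‖ ≤
        C0 * ((∫ t in Set.Ioc 0 T, ‖f t‖) + ∫ t in Set.Ioc 0 T, ‖g t‖) := by
      rw [← integral_add hf.norm hg.norm, ← integral_const_mul]
      exact integral_mono hG.norm ((hf.norm.add hg.norm).const_mul _) fun t => hRb _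
    have h4 := mul_le_mul_of_nonneg_left h3
      (show 0 ≤ 2 * Real.exp ((2 * κ + 1) * T) by positivity)
    nlinarith
end

section
/- Under the setup, assume the range of B is closed in Q' and the inf-sup condition with constant β > 0 holds (‖B*q‖_{V'} ≥ β‖q‖_Q for all q ∈ H⊥ and ‖Bv‖_{Q'} ≥ β‖v‖_V for all v ∈ K⊥). Then there exist positive constants C₁,…,C₁₆, depending only on α₀, β, γ₀, ‖a‖, ‖b‖, ‖c‖, C_{k₁},…,C_{k₄} and T, such that every solution (u,p) of Problem (P) satisfies: ‖ū‖_{L¹(J;V)} ≤ C₉‖f̄‖_{L¹(J;V')} + C₁₃‖f₀‖_{L¹(J;V')} + C₃‖ḡ‖_{L¹(J;Q')} + C₇‖g₀‖_{L¹(J;Q')}; ‖u₀‖_{L¹(J;V)} ≤ C₁₀‖f̄‖ + C₁₄‖f₀‖ + C₄‖ḡ‖ + C₈‖g₀‖; ‖p̄‖_{L¹(J;Q)} ≤ C₁₁‖f̄‖ + C₁₅‖f₀‖ + C₁‖ḡ‖ + C₅‖g₀‖; and ‖p₀‖_{L¹(J;Q)} ≤ C₁₂‖f̄‖ + C₁₆‖f₀‖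 + C₂‖ḡ‖ + C₆‖g₀‖. -/
open MeasureTheory

lemma aux_alg {X D E m : ℝ} (hX : 0 ≤ X) (hD : 0 ≤ D) (hm : 0 ≤ m)
    (h1 : X ^ 2 ≤ m * (D ^ 2 + E)) (h2 : E ≤ D * X) : X ≤ (1 + m) * D := by
  by_contra hc
  push Not at hc
  have h3 : m * E ≤ m * (D * X) := mul_le_mul_of_nonneg_left h2 hm
  have hDX : D ≤ X := by nlinarith [mul_nonneg hm hD]
  have hXp : 0 < X := lt_of_le_of_lt (by positivity) hc
  have h4 : (1 + m) * D * X < X * X := mul_lt_mul_of_pos_right hc hXp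
  have h5 : D * ((1+m) * D) ≤ D * X := mul_le_mul_of_nonneg_left hc.le hD
  nlinarith [sq_nonneg D]

lemma aux_psd {V : Type} [NormedAddCommGroup V] [InnerProductSpace ℝ V]
    (a : V →L[ℝ] V →L[ℝ] ℝ) (hs : ∀ v w : V, a v w = a w v) (hp : ∀ v : V, 0 ≤ a v v)
    {N : ℝ} (hN : ‖a‖ ≤ N) (u : V) : ‖a u‖ ^ 2 ≤ N * a u u := by
  have hN0 : 0 ≤ N := (norm_nonneg a).trans hN
  have key : ∀ v, (a u v) ^ 2 ≤ a u u * a v v := by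
    intro v
    have h : ∀ x : ℝ, 0 ≤ a v v * (x * x) + (2 * a u v) * x + a u u := by
      intro x
      have := hp (u + x • v)
      simp only [map_add, map_smul, add_apply, smul_apply,
        smul_eq_mul] at this
      rw [hs v u] at this
      linarith
    have := discrim_le_zero h
    unfold discrim at this
    nlinarith
  have hv : ∀ v, a v v ≤ N * ‖v‖ ^ 2 := by
    intro v
    have := (le_abs_self _).trans (a.le_opNorm₂ v v)
    have h2 : ‖a‖ * ‖v‖ * ‖v‖ ≤ N * ‖v‖ * ‖v‖ := by gcongr
    nlinarith
  have : ‖a u‖ ≤ Real.sqrt (N * a u u) := by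
    apply ContinuousLinearMap.opNorm_le_bound _ (Real.sqrt_nonneg _)
    intro v
    rw [Real.norm_eq_abs]
    apply abs_le_of_sq_le_sq _ (by positivity)
    rw [mul_pow, Real.sq_sqrt (mul_nonneg hN0 (hp u))]
    have := mul_le_mul_of_nonneg_left (hv v) (hp u)
    nlinarith [key v]
  calc ‖a u‖ ^ 2 ≤ (Real.sqrt (N * a u u)) ^ 2 := by gcongr
    _ = _ := Real.sq_sqrt (mul_nonneg hN0 (hp u))

lemma aux_par {V : Type} [NormedAddCommGroup V] [InnerProductSpace ℝ V]
    (a : V →L[ℝ] V →L[ℝ] ℝ) (hs : ∀ v w : V, a v w = a w v) (hp : ∀ v : V, 0 ≤ a v v)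
    {N : ℝ} (hN : ‖a‖ ≤ N) (u x y : V) (h : u = x + y) :
    a x x ≤ 2 * a u u + 2 * N * ‖y‖ ^ 2 := by
  have h1 := hp (u + y)
  have hx : x = u - y := by rw [h]; abel
  have h2 := (le_abs_self _).trans (a.le_opNorm₂ y y)
  have h3 : ‖a‖ * ‖y‖ * ‖y‖ ≤ N * ‖y‖ * ‖y‖ := by gcongr
  rw [hx]
  simp only [map_add, map_sub, add_apply, sub_apply] at h1 ⊢
  nlinarith [hs u y]

noncomputable def auxM (α β γ Na Nb Nc : ℝ) : ℝ :=
  4 * (2 / β ^ 2 * (1 + Nc) + 2 / β ^ 2 * (1 + Na)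
    + (2 + 2 * Na * (2 / β ^ 2 * (1 + Nc))) / α
    + (2 + 2 * Nc * (2 / β ^ 2 * (1 + Na))) / γ)

lemma auxM_nonneg {α β γ Na Nb Nc : ℝ} (hα : 0 < α) (hβ : 0 < β) (hγ : 0 < γ)
    (hNa : 0 ≤ Na) (hNc : 0 ≤ Nc) : 0 ≤ auxM α β γ Na Nb Nc := by
  unfold auxM; positivity

lemma aux_bd {β x g s E D n : ℝ} (hβ : 0 < β) (hx : 0 ≤ x) (hg : 0 ≤ g) (hs : 0 ≤ s)
    (hE : 0 ≤ E) (hn : 0 ≤ n)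
    (hgD : g ≤ D) (h : β * x ≤ g + s) (h2 : s ^ 2 ≤ n * E) :
    x ^ 2 ≤ 2 / β ^ 2 * (1 + n) * (D ^ 2 + E) := by
  have h3 : (β * x) ^ 2 ≤ (g + s) ^ 2 := by gcongr
  have h4 : g ^ 2 ≤ D ^ 2 := by gcongr
  have h5 : β ^ 2 * x ^ 2 ≤ 2 * ((1 + n) * (D ^ 2 + E)) := by
    nlinarith [sq_nonneg (g - s), mul_nonneg hn (sq_nonneg D)]
  have : 2 / β ^ 2 * (1 + n) * (D ^ 2 + E) = (2 * ((1 + n) * (D ^ 2 + E))) / β ^ 2 := by ring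
  rw [this, le_div_iff₀ (by positivity)]
  linarith

lemma aux_bd2 {α x e y E D n k : ℝ} (hα : 0 < α) (hn : 0 ≤ n) (heE : e ≤ E)
    (h : α * x ^ 2 ≤ 2 * e + 2 * n * y ^ 2) (hy : y ^ 2 ≤ k * (D ^ 2 + E)) :
    x ^ 2 ≤ (2 + 2 * n * k) / α * (D ^ 2 + E) := by
  rw [div_mul_eq_mul_div, le_div_iff₀ hα]
  have := mul_le_mul_of_nonneg_left hy hn
  nlinarith [sq_nonneg D]

lemma aux_point {α₀ β γ₀ Na Nb Nc : ℝ} (hα : 0 < α₀) (hβ : 0 < β) (hγ : 0 < γ₀)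
    (hNa : 0 ≤ Na) (hNc : 0 ≤ Nc)
    {V Q : Type} [NormedAddCommGroup V] [InnerProductSpace ℝ V]
    [NormedAddCommGroup Q] [InnerProductSpace ℝ Q]
    (a : V →L[ℝ] V →L[ℝ] ℝ) (b : V →L[ℝ] Q →L[ℝ] ℝ) (c : Q →L[ℝ] Q →L[ℝ] ℝ)
    (hsa : ∀ v w : V, a v w = a w v) (hpa : ∀ v : V, 0 ≤ a v v)
    (hsc : ∀ q r : Q, c q r = c r q) (hpc : ∀ q : Q, 0 ≤ c q q)
    (ha : ‖a‖ ≤ Na) (hc : ‖c‖ ≤ Nc)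
    (hca : ∀ v ∈ LinearMap.ker b.toLinearMap, α₀ * ‖v‖ ^ 2 ≤ a v v)
    (hcc : ∀ q ∈ LinearMap.ker b.flip.toLinearMap, γ₀ * ‖q‖ ^ 2 ≤ c q q)
    (hbq : ∀ q ∈ (LinearMap.ker b.flip.toLinearMap)ᗮ, β * ‖q‖ ≤ ‖b.flip q‖)
    (hbv : ∀ v ∈ (LinearMap.ker b.toLinearMap)ᗮ, β * ‖v‖ ≤ ‖b v‖)
    (u u₀ ub : V) (p p₀ pb : Q)
    (hu₀ : u₀ ∈ LinearMap.ker b.toLinearMap) (hub : ub ∈ (LinearMap.ker b.toLinearMap)ᗮ)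
    (hu : u = u₀ + ub)
    (hp₀ : p₀ ∈ LinearMap.ker b.flip.toLinearMap)
    (hpb : pb ∈ (LinearMap.ker b.flip.toLinearMap)ᗮ) (hp : p = p₀ + pb)
    (F : V →L[ℝ] ℝ) (G : Q →L[ℝ] ℝ) (hF : F = a u + b.flip p) (hG : G = b u - c p) :
    ‖u‖ + ‖p‖ ≤ (1 + auxM α₀ β γ₀ Na Nb Nc) * (‖F‖ + ‖G‖) := by
  have hE : a u u + c p p = F u - G p := by
    rw [hF, hG]; simp; ring
  have hbu : b u = b ub := by
    have : b u₀ = 0 := hu₀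
    rw [hu, map_add, this, zero_add]
  have hbp : b.flip p = b.flip pb := by
    have : b.flip p₀ = 0 := hp₀
    rw [hp, map_add, this, zero_add]
  set D := ‖F‖ + ‖G‖ with hD
  set E := a u u + c p p with hEE
  have hE0 : 0 ≤ E := add_nonneg (hpa u) (hpc p)
  have h1 : ‖ub‖ ^ 2 ≤ 2 / β ^ 2 * (1 + Nc) * (D ^ 2 + E) := by
    refine aux_bd (g := ‖G‖) (s := ‖c p‖) hβ (norm_nonneg _) (norm_nonneg _) (norm_nonneg _) hE0 hNc
      (by linarith [norm_nonneg F]) ?_ ?_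
    · refine (hbv ub hub).trans ?_
      have : b ub = G + c p := by rw [hG, hbu]; abel
      rw [this]; exact norm_add_le _ _
    · refine (aux_psd c hsc hpc hc p).trans ?_
      gcongr; linarith [hpa u]
  have h2 : ‖pb‖ ^ 2 ≤ 2 / β ^ 2 * (1 + Na) * (D ^ 2 + E) := by
    refine aux_bd (g := ‖F‖) (s := ‖a u‖) hβ (norm_nonneg _) (norm_nonneg _) (norm_nonneg _) hE0 hNa
      (by linarith [norm_nonneg G]) ?_ ?_
    · refine (hbq pb hpb).trans ?_
      have : b.flip pb = F - a u := by rw [hF, hbp]; abel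
      rw [this]; exact norm_sub_le _ _
    · refine (aux_psd a hsa hpa ha u).trans ?_
      gcongr; linarith [hpc p]
  have h3 := aux_bd2 (e := a u u) (E := E) (D := D) hα hNa (by linarith [hpc p])
    ((hca u₀ hu₀).trans (aux_par a hsa hpa ha u u₀ ub hu)) h1
  have h4 := aux_bd2 (e := c p p) (E := E) (D := D) hγ hNc (by linarith [hpa u])
    ((hcc p₀ hp₀).trans (aux_par c hsc hpc hc p p₀ pb hp)) h2
  refine aux_alg (E := E) (by positivity) (by positivity) (auxM_nonneg hα hβ hγ hNa hNc) ?_ ?_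
  · have hX : ‖u‖ + ‖p‖ ≤ ‖u₀‖ + ‖ub‖ + (‖p₀‖ + ‖pb‖) := by
      rw [hu, hp]; exact add_le_add (norm_add_le _ _) (norm_add_le _ _)
    have hX2 : (‖u‖ + ‖p‖) ^ 2 ≤ (‖u₀‖ + ‖ub‖ + (‖p₀‖ + ‖pb‖)) ^ 2 := by gcongr
    have hX3 : (‖u₀‖ + ‖ub‖ + (‖p₀‖ + ‖pb‖)) ^ 2
        ≤ 4 * (‖u₀‖ ^ 2 + ‖ub‖ ^ 2 + ‖p₀‖ ^ 2 + ‖pb‖ ^ 2) := by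
      nlinarith [sq_nonneg (‖u₀‖ - ‖ub‖), sq_nonneg (‖u₀‖ - ‖p₀‖), sq_nonneg (‖u₀‖ - ‖pb‖),
        sq_nonneg (‖ub‖ - ‖p₀‖), sq_nonneg (‖ub‖ - ‖pb‖), sq_nonneg (‖p₀‖ - ‖pb‖)]
    unfold auxM
    linarith
  · rw [hE]
    have e1 := (le_abs_self _).trans (F.le_opNorm u)
    have e2 := (neg_le_abs _).trans (G.le_opNorm p)
    nlinarith [mul_nonneg (norm_nonneg F) (norm_nonneg p), mul_nonneg (norm_nonneg G) (norm_nonneg u)]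

lemma aux_gron {T L : ℝ} (hT : 0 < T) (hL : 0 ≤ L) {y h : ℝ → ℝ}
    (hy : IntervalIntegrable y volume 0 T) (hh : IntervalIntegrable h volume 0 T)
    (hh0 : ∀ t, 0 ≤ h t)
    (H : ∀ᵐ t ∂volume, t ∈ Set.Icc (0:ℝ) T → y t ≤ h t + L * ∫ s in (0:ℝ)..t, y s) :
    ∫ t in (0:ℝ)..T, y t ≤ Real.exp (L * T) * ∫ t in (0:ℝ)..T, h t := by
  set H0 := ∫ t in (0:ℝ)..T, h t with hH0
  have hsub : ∀ {w : ℝ → ℝ}, IntervalIntegrable w volume 0 T → ∀ t ∈ Set.Icc (0:ℝ) T,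
      IntervalIntegrable w volume 0 t := by
    intro w hw t ht
    refine hw.mono_set ?_
    rw [Set.uIcc_of_le ht.1, Set.uIcc_of_le hT.le]
    exact Set.Icc_subset_Icc_right ht.2
  set Y : ℝ → ℝ := fun t => ∫ s in (0:ℝ)..t, y s with hY
  have hYc : ContinuousOn Y (Set.Icc 0 T) := by
    have := intervalIntegral.continuousOn_primitive_interval' hy (Set.left_mem_uIcc)
    rwa [Set.uIcc_of_le hT.le] at this
  have hYi : IntervalIntegrable Y volume 0 T := by
    apply ContinuousOn.intervalIntegrable
    rwa [Set.uIcc_of_le hT.le]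
  set Z : ℝ → ℝ := fun t => H0 + L * ∫ s in (0:ℝ)..t, Y s with hZ
  have hYZ : ∀ t ∈ Set.Icc (0:ℝ) T, Y t ≤ Z t := by
    intro t ht
    have i1 := hsub hh t ht
    have i2 := (hsub hYi t ht).const_mul L
    have : Y t ≤ ∫ s in (0:ℝ)..t, (h s + L * Y s) := by
      apply intervalIntegral.integral_mono_ae_restrict ht.1 (hsub hy t ht) (i1.add i2)
      rw [Filter.EventuallyLE, ae_restrict_iff' measurableSet_Icc]
      filter_upwards [H] with s hs hst
      exact hs ⟨hst.1, hst.2.trans ht.2⟩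
    rw [intervalIntegral.integral_add i1 i2, intervalIntegral.integral_const_mul] at this
    have h2 : ∫ s in (0:ℝ)..t, h s ≤ H0 :=
      intervalIntegral.integral_mono_interval le_rfl ht.1 ht.2
        (Filter.Eventually.of_forall hh0) hh
    simp only [hZ]; linarith
  have hZc : ContinuousOn Z (Set.Icc 0 T) := by
    have := intervalIntegral.continuousOn_primitive_interval' hYi (Set.left_mem_uIcc)
    rw [Set.uIcc_of_le hT.le] at this
    exact continuousOn_const.add (continuousOn_const.mul this)
  have hZd : ∀ t ∈ Set.Ioo (0:ℝ) T, HasDerivAt Z (L * Y t) t := by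
    intro t ht
    have hn : Set.Icc (0:ℝ) T ∈ nhds t := Icc_mem_nhds ht.1 ht.2
    have : HasDerivAt (fun t => ∫ s in (0:ℝ)..t, Y s) (Y t) t := by
      apply intervalIntegral.integral_hasDerivAt_right (hsub hYi t ⟨ht.1.le, ht.2.le⟩)
      · exact (hYc.mono Set.Ioo_subset_Icc_self).stronglyMeasurableAtFilter isOpen_Ioo t ht
      · exact hYc.continuousAt hn
    exact (this.const_mul L).const_add H0
  have anti : AntitoneOn (fun t => Real.exp (-(L * t)) * Z t) (Set.Icc 0 T) := by
    have hd : ∀ t ∈ Set.Ioo (0:ℝ) T, HasDerivAt (fun t => Real.exp (-(L * t)) * Z t)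
        (Real.exp (-(L * t)) * (-(L * 1)) * Z t + Real.exp (-(L * t)) * (L * Y t)) t := by
      intro t ht
      exact (((hasDerivAt_id t).const_mul L).neg.exp).mul (hZd t ht)
    apply antitoneOn_of_deriv_nonpos (convex_Icc _ _)
    · exact ContinuousOn.mul (by fun_prop) hZc
    · rw [interior_Icc]
      intro t ht
      exact (hd t ht).differentiableAt.differentiableWithinAt
    · rw [interior_Icc]
      intro t ht
      rw [(hd t ht).deriv]
      have := mul_le_mul_of_nonneg_left (hYZ t ⟨ht.1.le, ht.2.le⟩)
        (mul_nonneg (Real.exp_pos (-(L * t))).le hL)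
      linarith
  have h1 := anti (Set.left_mem_Icc.2 hT.le) (Set.right_mem_Icc.2 hT.le) hT.le
  simp only [mul_zero, neg_zero, Real.exp_zero, one_mul] at h1
  have h2 : Z 0 = H0 := by simp [hZ]
  have h3 := hYZ T (Set.right_mem_Icc.2 hT.le)
  rw [h2, Real.exp_neg, inv_mul_le_iff₀ (Real.exp_pos _)] at h1
  exact h3.trans h1

lemma aux_ker {T C : ℝ} {k : ℝ → ℝ → ℝ}
    (h : ∀ᵐ ts : ℝ × ℝ ∂volume, 0 ≤ ts.2 → ts.2 ≤ ts.1 → ts.1 ≤ T → |k ts.1 ts.2| ≤ C) :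
    ∀ᵐ t : ℝ, t ∈ Set.Icc (0:ℝ) T → ∀ᵐ s : ℝ, s ∈ Set.Ioc 0 t → |k t s| ≤ C := by
  have := Measure.ae_ae_of_ae_prod (μ := (volume : Measure ℝ)) (ν := (volume : Measure ℝ)) h
  filter_upwards [this] with t ht htT
  filter_upwards [ht] with s hs hst
  exact hs hst.1.le hst.2 htT.2

lemma aux_int {t B A : ℝ} (ht : 0 ≤ t) {w y : ℝ → ℝ} (hy : IntervalIntegrable y volume 0 t)
    (h : ∀ᵐ s : ℝ, s ∈ Set.Ioc 0 t → |w s| ≤ B * y s * A) :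
    |∫ s in (0:ℝ)..t, w s| ≤ (B * ∫ s in (0:ℝ)..t, y s) * A := by
  rw [← intervalIntegral.integral_const_mul, ← intervalIntegral.integral_mul_const]
  exact intervalIntegral.norm_integral_le_of_norm_le (f := w) ht h ((hy.const_mul B).mul_const A)

lemma aux_mono {T : ℝ} (hT : 0 < T) {x y : ℝ → ℝ} (hy : IntervalIntegrable y volume 0 T)
    (h0 : ∀ t, 0 ≤ x t) (h : ∀ t, x t ≤ y t) :
    ∫ t in (0:ℝ)..T, x t ≤ ∫ t in (0:ℝ)..T, y t := by
  rw [intervalIntegral.integral_of_le hT.le, intervalIntegral.integral_of_le hT.le]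
  exact integral_mono_of_nonneg (Filter.Eventually.of_forall h0) hy.1
    (Filter.Eventually.of_forall h)

lemma aux_norm_le {V : Type} [NormedAddCommGroup V] [InnerProductSpace ℝ V]
    (K : Submodule ℝ V) (u x y : V) (hx : x ∈ K) (hy : y ∈ Kᗮ) (h : u = x + y) :
    ‖x‖ ≤ ‖u‖ ∧ ‖y‖ ≤ ‖u‖ := by
  have h1 : inner ℝ x y = 0 := (Submodule.mem_orthogonal K y).1 hy x hx
  have h2 : ‖u‖ * ‖u‖ = ‖x‖ * ‖x‖ + ‖y‖ * ‖y‖ := by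
    rw [h]; exact norm_add_sq_eq_norm_sq_add_norm_sq_of_inner_eq_zero x y h1
  constructor <;>
  · apply le_of_sq_le_sq _ (norm_nonneg _)
    nlinarith [mul_self_nonneg ‖x‖, mul_self_nonneg ‖y‖]

lemma aux_data {T : ℝ} {V : Type} [NormedAddCommGroup V] [InnerProductSpace ℝ V] [CompleteSpace V]
    (K : Submodule ℝ V) (hK : IsClosed (K : Set V)) (f f₀ fb : ℝ → V →L[ℝ] ℝ)
    (hf : IntervalIntegrable f volume 0 T)
    (h : ∀ t : ℝ, (∀ v ∈ K, f₀ t v = f t v ∧ fb t v = 0) ∧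
            (∀ v ∈ Kᗮ, f₀ t v = 0 ∧ fb t v = f t v)) :
    IntervalIntegrable f₀ volume 0 T ∧ IntervalIntegrable fb volume 0 T ∧
      ∀ t, ‖f t‖ ≤ ‖f₀ t‖ + ‖fb t‖ := by
  haveI : CompleteSpace K := hK.completeSpace_coe
  have hsum : ∀ t, f t = f₀ t + fb t := by
    intro t
    ext v
    obtain ⟨x, hx, y, hy, rfl⟩ := K.exists_add_mem_mem_orthogonal v
    have h1 := (h t).1 x hx
    have h2 := (h t).2 y hy
    simp [h1, h2]
  have hf₀ : f₀ = fun t => ((ContinuousLinearMap.compL ℝ V V ℝ).flip K.starProjection) (f t) := by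
    funext t
    ext v
    obtain ⟨x, hx, y, hy, rfl⟩ := K.exists_add_mem_mem_orthogonal v
    have h1 := (h t).1 x hx
    have h2 := (h t).2 y hy
    have e1 : K.starProjection x = x := Submodule.starProjection_eq_self_iff.2 hx
    have e2 : K.starProjection y = 0 := (Submodule.starProjection_apply_eq_zero_iff K).2 hy
    simp [h1, h2, e1, e2]
  have i0 : IntervalIntegrable f₀ volume 0 T := by
    rw [hf₀]
    exact ⟨ContinuousLinearMap.integrable_comp _ hf.1, ContinuousLinearMap.integrable_comp _ hf.2⟩
  have hfb : fb = fun t => f t - f₀ t := by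
    funext t; rw [hsum t]; abel
  refine ⟨i0, ?_, fun t => by rw [hsum t]; exact norm_add_le _ _⟩
  rw [hfb]; exact hf.sub i0

/-- Under the closed-range and inf-sup assumptions there are positive
constants `C₁, …, C₁₆` (here `C i = C_{i+1}` for `i : Fin 16`), depending only on
`α₀, β, γ₀, ‖a‖, ‖b‖, ‖c‖, C_{k₁},…,C_{k₄}, T`, such that every solution `(u,p)` of
Problem (P) satisfies the four componentwise stability bounds of Theorem 2.6:
`‖ū‖ ≤ C₉‖f̄‖ + C₁₃‖f₀‖ + C₃‖ḡ‖ + C₇‖g₀‖`,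
`‖u₀‖ ≤ C₁₀‖f̄‖ + C₁₄‖f₀‖ + C₄‖ḡ‖ + C₈‖g₀‖`,
`‖p̄‖ ≤ C₁₁‖f̄‖ + C₁₅‖f₀‖ + C₁‖ḡ‖ + C₅‖g₀‖`,
`‖p₀‖ ≤ C₁₂‖f̄‖ + C₁₆‖f₀‖ + C₂‖ḡ‖ + C₆‖g₀‖`, all in `L¹` norms on `J`. -/
theorem statement1
    (α₀ β γ₀ Na Nb Nc Ck1 Ck2 Ck3 Ck4 T : ℝ)
    (hα₀ : 0 < α₀) (hβ : 0 < β) (hγ₀ : 0 < γ₀) (hT : 0 < T)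
    (hNa : 0 ≤ Na) (hNb : 0 ≤ Nb) (hNc : 0 ≤ Nc)
    (hCk1 : 0 ≤ Ck1) (hCk2 : 0 ≤ Ck2) (hCk3 : 0 ≤ Ck3) (hCk4 : 0 ≤ Ck4) :
    ∃ C : Fin 16 → ℝ, (∀ i, 0 < C i) ∧
      ∀ (V Q : Type)
        [NormedAddCommGroup V] [InnerProductSpace ℝ V] [CompleteSpace V]
        [NormedAddCommGroup Q] [InnerProductSpace ℝ Q] [CompleteSpace Q]
        (a : V →L[ℝ] V →L[ℝ] ℝ) (b : V →L[ℝ] Q →L[ℝ] ℝ) (c : Q →L[ℝ] Q →L[ℝ] ℝ)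
        (k₁ k₂ k₃ k₄ : ℝ → ℝ → ℝ) (f : ℝ → V →L[ℝ] ℝ) (g : ℝ → Q →L[ℝ] ℝ),
        (∀ v w : V, a v w = a w v) → (∀ v : V, 0 ≤ a v v) →
        (∀ q r : Q, c q r = c r q) → (∀ q : Q, 0 ≤ c q q) →
        ‖a‖ ≤ Na → ‖b‖ ≤ Nb → ‖c‖ ≤ Nc →
        (∀ v ∈ LinearMap.ker b.toLinearMap, α₀ * ‖v‖ ^ 2 ≤ a v v) →
        (∀ q ∈ LinearMap.ker b.flip.toLinearMap, γ₀ * ‖q‖ ^ 2 ≤ c q q) →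
        IsClosed (Set.range fun v : V => (b v : Q →L[ℝ] ℝ)) →
        (∀ q ∈ (LinearMap.ker b.flip.toLinearMap)ᗮ, β * ‖q‖ ≤ ‖b.flip q‖) →
        (∀ v ∈ (LinearMap.ker b.toLinearMap)ᗮ, β * ‖v‖ ≤ ‖b v‖) →
        Measurable (Function.uncurry k₁) → Measurable (Function.uncurry k₂) →
        Measurable (Function.uncurry k₃) → Measurable (Function.uncurry k₄) →
        (∀ᵐ ts : ℝ × ℝ ∂volume,
          0 ≤ ts.2 → ts.2 ≤ ts.1 → ts.1 ≤ T → |k₁ ts.1 ts.2| ≤ Ck1) →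
        (∀ᵐ ts : ℝ × ℝ ∂volume,
          0 ≤ ts.2 → ts.2 ≤ ts.1 → ts.1 ≤ T → |k₂ ts.1 ts.2| ≤ Ck2) →
        (∀ᵐ ts : ℝ × ℝ ∂volume,
          0 ≤ ts.2 → ts.2 ≤ ts.1 → ts.1 ≤ T → |k₃ ts.1 ts.2| ≤ Ck3) →
        (∀ᵐ ts : ℝ × ℝ ∂volume,
          0 ≤ ts.2 → ts.2 ≤ ts.1 → ts.1 ≤ T → |k₄ ts.1 ts.2| ≤ Ck4) →
        IntervalIntegrable f volume 0 T → IntervalIntegrable g volume 0 T →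
        ∀ (u : ℝ → V) (p : ℝ → Q),
          IntervalIntegrable u volume 0 T → IntervalIntegrable p volume 0 T →
          SolvesP V Q T a b c k₁ k₂ k₃ k₄ f g u p →
          -- orthogonal decompositions of the solution
          ∀ (u₀ ubar : ℝ → V) (p₀ pbar : ℝ → Q),
          (∀ t : ℝ, u₀ t ∈ LinearMap.ker b.toLinearMap ∧ ubar t ∈ (LinearMap.ker b.toLinearMap)ᗮ ∧
            u t = u₀ t + ubar t) →
          (∀ t : ℝ, p₀ t ∈ LinearMap.ker b.flip.toLinearMap ∧
            pbar t ∈ (LinearMap.ker b.flip.toLinearMap)ᗮ ∧ p t = p₀ t + pbar t) →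
          -- corresponding decompositions of the data
          ∀ (f₀ fbar : ℝ → V →L[ℝ] ℝ) (g₀ gbar : ℝ → Q →L[ℝ] ℝ),
          (∀ t : ℝ, (∀ v ∈ LinearMap.ker b.toLinearMap, f₀ t v = f t v ∧ fbar t v = 0) ∧
            (∀ v ∈ (LinearMap.ker b.toLinearMap)ᗮ, f₀ t v = 0 ∧ fbar t v = f t v)) →
          (∀ t : ℝ, (∀ q ∈ LinearMap.ker b.flip.toLinearMap, g₀ t q = g t q ∧ gbar t q = 0) ∧
            (∀ q ∈ (LinearMap.ker b.flip.toLinearMap)ᗮ, g₀ t q = 0 ∧ gbar t q = g t q)) →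
          (∫ t in (0:ℝ)..T, ‖ubar t‖)
            ≤ C 8 * (∫ t in (0:ℝ)..T, ‖fbar t‖) + C 12 * (∫ t in (0:ℝ)..T, ‖f₀ t‖)
              + C 2 * (∫ t in (0:ℝ)..T, ‖gbar t‖) + C 6 * (∫ t in (0:ℝ)..T, ‖g₀ t‖) ∧
          (∫ t in (0:ℝ)..T, ‖u₀ t‖)
            ≤ C 9 * (∫ t in (0:ℝ)..T, ‖fbar t‖) + C 13 * (∫ t in (0:ℝ)..T, ‖f₀ t‖)
              + C 3 * (∫ t in (0:ℝ)..T, ‖gbar t‖) + C 7 * (∫ t in (0:ℝ)..T, ‖g₀ t‖) ∧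
          (∫ t in (0:ℝ)..T, ‖pbar t‖)
            ≤ C 10 * (∫ t in (0:ℝ)..T, ‖fbar t‖) + C 14 * (∫ t in (0:ℝ)..T, ‖f₀ t‖)
              + C 0 * (∫ t in (0:ℝ)..T, ‖gbar t‖) + C 4 * (∫ t in (0:ℝ)..T, ‖g₀ t‖) ∧
          (∫ t in (0:ℝ)..T, ‖p₀ t‖)
            ≤ C 11 * (∫ t in (0:ℝ)..T, ‖fbar t‖) + C 15 * (∫ t in (0:ℝ)..T, ‖f₀ t‖)
              + C 1 * (∫ t in (0:ℝ)..T, ‖gbar t‖) + C 5 * (∫ t in (0:ℝ)..T, ‖g₀ t‖) := by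
  set M := 1 + auxM α₀ β γ₀ Na Nb Nc with hM
  have hM1 : 0 < M := by
    have := auxM_nonneg (Nb := Nb) hα₀ hβ hγ₀ hNa hNc
    linarith
  set K := Ck1 * Na + Ck2 * Nb + Ck3 * Nb + Ck4 * Nc with hK
  have hK0 : 0 ≤ K := by positivity
  set L := M * (2 * K) with hL
  have hL0 : 0 ≤ L := by positivity
  refine ⟨fun _ => Real.exp (L * T) * M, fun _ => by positivity, ?_⟩
  intro V Q _ _ _ _ _ _ a b c k₁ k₂ k₃ k₄ f g hsa hpa hsc hpc ha hb hc hca hcc _ hbq hbv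
    _ _ _ _ hk1 hk2 hk3 hk4 hf hg u p hu hp hsol u₀ ubar p₀ pbar hud hpd f₀ fbar g₀ gbar hfd hgd
  obtain ⟨if0, ifb, hfle⟩ := aux_data _ b.isClosed_ker f f₀ fbar hf hfd
  obtain ⟨ig0, igb, hgle⟩ := aux_data _ b.flip.isClosed_ker g g₀ gbar hg hgd
  set y : ℝ → ℝ := fun t => ‖u t‖ + ‖p t‖ with hy
  have iy : IntervalIntegrable y volume 0 T := hu.norm.add hp.norm
  have ih : IntervalIntegrable (fun t => M * (‖fbar t‖ + ‖f₀ t‖ + ‖gbar t‖ + ‖g₀ t‖)) volume 0 T :=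
    (((ifb.norm.add if0.norm).add igb.norm).add ig0.norm).const_mul M
  have main : ∫ t in (0:ℝ)..T, y t ≤ Real.exp (L * T) *
      ∫ t in (0:ℝ)..T, M * (‖fbar t‖ + ‖f₀ t‖ + ‖gbar t‖ + ‖g₀ t‖) := by
    refine aux_gron hT hL0 iy ih (fun t => by positivity) ?_
    filter_upwards [hsol, aux_ker hk1, aux_ker hk2, aux_ker hk3, aux_ker hk4]
      with t hs h1 h2 h3 h4 ht
    obtain ⟨hs1, hs2⟩ := hs ht
    replace h1 := h1 ht
    replace h2 := h2 ht
    replace h3 := h3 ht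
    replace h4 := h4 ht
    have iyt : IntervalIntegrable y volume 0 t := by
      refine iy.mono_set ?_
      rw [Set.uIcc_of_le ht.1, Set.uIcc_of_le hT.le]
      exact Set.Icc_subset_Icc_right ht.2
    set I := ∫ s in (0:ℝ)..t, y s with hI
    have hI0 : 0 ≤ I := intervalIntegral.integral_nonneg ht.1 (fun s _ => by positivity)
    have ba : ∀ x v, |a x v| ≤ Na * ‖x‖ * ‖v‖ := fun x v =>
      (a.le_opNorm₂ x v).trans (by gcongr)
    have bb : ∀ x q, |b x q| ≤ Nb * ‖x‖ * ‖q‖ := fun x v =>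
      (b.le_opNorm₂ x v).trans (by gcongr)
    have bc : ∀ x v, |c x v| ≤ Nc * ‖x‖ * ‖v‖ := fun x v =>
      (c.le_opNorm₂ x v).trans (by gcongr)
    have hF : ‖a (u t) + b.flip (p t)‖ ≤ ‖f t‖ + K * I := by
      refine ContinuousLinearMap.opNorm_le_bound _ (by positivity) fun v => ?_
      have e : (a (u t) + b.flip (p t)) v = a (u t) v + b v (p t) := rfl
      rw [e, hs1 v, add_mul]
      refine (norm_add_le _ _).trans (add_le_add ((f t).le_opNorm v) ?_)
      refine aux_int ht.1 iyt ?_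
      filter_upwards [h1, h2] with s g1 g2 hst
      refine (abs_add_le _ _).trans ?_
      rw [abs_mul, abs_mul]
      have r1 : |k₁ t s| * |a (u s) v| ≤ Ck1 * (Na * ‖u s‖ * ‖v‖) := by
        gcongr
        · exact g1 hst
        · exact ba _ _
      have r2 : |k₂ t s| * |b v (p s)| ≤ Ck2 * (Nb * ‖v‖ * ‖p s‖) := by
        gcongr
        · exact g2 hst
        · exact bb _ _
      refine (add_le_add r1 r2).trans ?_
      have : K * y s * ‖v‖ - (Ck1 * (Na * ‖u s‖ * ‖v‖) + Ck2 * (Nb * ‖v‖ * ‖p s‖))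
        = Ck1 * Na * ‖p s‖ * ‖v‖ + Ck2 * Nb * ‖u s‖ * ‖v‖
          + (Ck3 * Nb + Ck4 * Nc) * (‖u s‖ + ‖p s‖) * ‖v‖ := by
        simp only [hK, hy]; ring
      have : 0 ≤ K * y s * ‖v‖ - (Ck1 * (Na * ‖u s‖ * ‖v‖) + Ck2 * (Nb * ‖v‖ * ‖p s‖)) := by
        rw [this]; positivity
      linarith
    have hG : ‖b (u t) - c (p t)‖ ≤ ‖g t‖ + K * I := by
      refine ContinuousLinearMap.opNorm_le_bound _ (by positivity) fun v => ?_
      have e : (b (u t) - c (p t)) v = b (u t) v - c (p t) v := rfl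
      rw [e, hs2 v, add_mul]
      refine (norm_add_le _ _).trans (add_le_add ((g t).le_opNorm v) ?_)
      refine aux_int ht.1 iyt ?_
      filter_upwards [h3, h4] with s g1 g2 hst
      refine (abs_sub _ _).trans ?_
      rw [abs_mul, abs_mul]
      have r1 : |k₃ t s| * |b (u s) v| ≤ Ck3 * (Nb * ‖u s‖ * ‖v‖) := by
        gcongr
        · exact g1 hst
        · exact bb _ _
      have r2 : |k₄ t s| * |c (p s) v| ≤ Ck4 * (Nc * ‖p s‖ * ‖v‖) := by
        gcongr
        · exact g2 hst
        · exact bc _ _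
      refine (add_le_add r1 r2).trans ?_
      have : K * y s * ‖v‖ - (Ck3 * (Nb * ‖u s‖ * ‖v‖) + Ck4 * (Nc * ‖p s‖ * ‖v‖))
        = Ck3 * Nb * ‖p s‖ * ‖v‖ + Ck4 * Nc * ‖u s‖ * ‖v‖
          + (Ck1 * Na + Ck2 * Nb) * (‖u s‖ + ‖p s‖) * ‖v‖ := by
        simp only [hK, hy]; ring
      have : 0 ≤ K * y s * ‖v‖ - (Ck3 * (Nb * ‖u s‖ * ‖v‖) + Ck4 * (Nc * ‖p s‖ * ‖v‖)) := by
        rw [this]; positivity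
      linarith
    have hpt := aux_point (Nb := Nb) hα₀ hβ hγ₀ hNa hNc a b c hsa hpa hsc hpc ha hc hca hcc hbq hbv
      (u t) (u₀ t) (ubar t) (p t) (p₀ t) (pbar t) (hud t).1 (hud t).2.1 (hud t).2.2
      (hpd t).1 (hpd t).2.1 (hpd t).2.2 _ _ rfl rfl
    have : M * (‖a (u t) + b.flip (p t)‖ + ‖b (u t) - c (p t)‖)
        ≤ M * (‖fbar t‖ + ‖f₀ t‖ + ‖gbar t‖ + ‖g₀ t‖ + 2 * K * I) := by
      apply mul_le_mul_of_nonneg_left _ hM1.le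
      linarith [hfle t, hgle t]
    calc y t ≤ _ := hpt
      _ ≤ _ := this
      _ = _ := by rw [hL]; ring
  rw [intervalIntegral.integral_const_mul,
    intervalIntegral.integral_add ((ifb.norm.add if0.norm).add igb.norm) ig0.norm,
    intervalIntegral.integral_add (ifb.norm.add if0.norm) igb.norm,
    intervalIntegral.integral_add ifb.norm if0.norm] at main
  have nu := fun t => aux_norm_le _ (u t) (u₀ t) (ubar t) (hud t).1 (hud t).2.1 (hud t).2.2
  have np := fun t => aux_norm_le _ (p t) (p₀ t) (pbar t) (hpd t).1 (hpd t).2.1 (hpd t).2.2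
  have fin : ∀ x : ℝ → ℝ, (∀ t, 0 ≤ x t) → (∀ t, x t ≤ y t) →
      ∫ t in (0:ℝ)..T, x t ≤ Real.exp (L * T) * M * (∫ t in (0:ℝ)..T, ‖fbar t‖)
        + Real.exp (L * T) * M * (∫ t in (0:ℝ)..T, ‖f₀ t‖)
        + Real.exp (L * T) * M * (∫ t in (0:ℝ)..T, ‖gbar t‖)
        + Real.exp (L * T) * M * (∫ t in (0:ℝ)..T, ‖g₀ t‖) := by
    intro x hx0 hxy
    have := aux_mono hT iy hx0 hxy
    linarith
  refine ⟨fin _ (fun t => norm_nonneg _) fun t => ?_, fin _ (fun t => norm_nonneg _) fun t => ?_,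
    fin _ (fun t => norm_nonneg _) fun t => ?_, fin _ (fun t => norm_nonneg _) fun t => ?_⟩
  · exact (nu t).2.trans (le_add_of_nonneg_right (norm_nonneg _))
  · exact (nu t).1.trans (le_add_of_nonneg_right (norm_nonneg _))
  · exact (np t).2.trans (le_add_of_nonneg_left (norm_nonneg _))
  · exact (np t).1.trans (le_add_of_nonneg_left (norm_nonneg _))
end

section
/- Suppose (u,p) ∈ L¹(J;V) × L¹(J;Q) satisfies the first equation of Problem (P) with f = 0 and with equal kernels k₁ = k₂ = k, where k is measurable with |k(t,s)| ≤ C_k a.e. on 0 ≤ s ≤ t ≤ T; that is, for a.e. t ∈ J and all v ∈ V, a(u(t),v) + b(v,p(t)) = ∫₀ᵗ k(t,s) [a(u(s),v) + b(v,p(s))] ds. Then for a.e. t ∈ J, A u(t) + B* p(t) = 0 in V'; equivalently a(u(t),v) + b(v,p(t)) = 0 for all v ∈ V. -/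
open MeasureTheory

lemma gron_aux (T C : ℝ) (hC : 0 ≤ C) (φ : ℝ → ℝ) (h0 : ∀ s, 0 ≤ φ s)
    (hφ : IntervalIntegrable φ volume 0 T) (hT : 0 < T)
    (h : ∀ᵐ t ∂volume, t ∈ Set.Icc (0:ℝ) T → φ t ≤ C * ∫ s in (0:ℝ)..t, φ s) :
    ∀ t ∈ Set.Icc (0:ℝ) T, (∫ s in (0:ℝ)..t, φ s) ≤ 0 := by
  have hsub : ∀ t ∈ Set.Icc (0:ℝ) T, IntervalIntegrable φ volume 0 t := by
    intro t ht
    apply hφ.mono_set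
    rw [Set.uIcc_of_le ht.1, Set.uIcc_of_le hT.le]
    exact Set.Icc_subset_Icc_right ht.2
  have key : ∀ n : ℕ, ∀ t ∈ Set.Icc (0:ℝ) T,
      (∫ s in (0:ℝ)..t, φ s) ≤ (∫ s in (0:ℝ)..T, φ s) * ((C * t) ^ n / n.factorial) := by
    intro n
    induction n with
    | zero =>
      intro t ht
      simp only [pow_zero, Nat.factorial_zero, Nat.cast_one, div_one, mul_one]
      exact intervalIntegral.integral_mono_interval le_rfl ht.1 ht.2
        (Filter.Eventually.of_forall h0) hφ
    | succ n ih =>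
      intro t ht
      set M := ∫ s in (0:ℝ)..T, φ s
      have e : (∫ s in (0:ℝ)..t, C * (M * ((C * s) ^ n / n.factorial)))
          = M * ((C * t) ^ (n+1) / (n+1).factorial) := by
        have : (fun s : ℝ => C * (M * ((C * s) ^ n / n.factorial)))
            = fun s => (C ^ (n+1) * M / n.factorial) * s ^ n := by
          funext s
          rw [mul_pow]; ring
        rw [this, intervalIntegral.integral_const_mul, integral_pow, Nat.factorial_succ]
        have h1 : (n.factorial : ℝ) ≠ 0 := by positivity
        have h2 : (n : ℝ) + 1 ≠ 0 := by positivity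
        push_cast
        rw [mul_pow]
        field_simp
        ring
      rw [← e]
      apply intervalIntegral.integral_mono_ae_restrict
      · exact ht.1
      · exact hsub t ht
      · apply Continuous.intervalIntegrable
        fun_prop
      · filter_upwards [ae_restrict_of_ae h, ae_restrict_mem measurableSet_Icc] with s hs hs1
        have hm : s ∈ Set.Icc (0:ℝ) T := ⟨hs1.1, hs1.2.trans ht.2⟩
        exact (hs hm).trans (mul_le_mul_of_nonneg_left (ih s hm) hC)
  intro t ht
  have lim := ((FloorSemiring.tendsto_pow_div_factorial_atTop (C * t)).const_mul
    (∫ s in (0:ℝ)..T, φ s))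
  rw [mul_zero] at lim
  exact ge_of_tendsto' lim (fun n => key n t ht)

/-- If `(u,p) ∈ L¹(J;V) × L¹(J;Q)` satisfies the first equation of
Problem (P) with `f = 0` and equal bounded kernels `k₁ = k₂ = k`, then for a.e. `t ∈ J`,
`A u(t) + B* p(t) = 0` in `V'`, i.e. `a(u(t),v) + b(v,p(t)) = 0` for all `v ∈ V`. -/
theorem statement2
    {V Q : Type*} [NormedAddCommGroup V] [InnerProductSpace ℝ V] [CompleteSpace V]
    [NormedAddCommGroup Q] [InnerProductSpace ℝ Q] [CompleteSpace Q]
    (T : ℝ) (hT : 0 < T)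
    (a : V →L[ℝ] V →L[ℝ] ℝ) (b : V →L[ℝ] Q →L[ℝ] ℝ)
    (ha_symm : ∀ v w : V, a v w = a w v) (ha_pos : ∀ v : V, 0 ≤ a v v)
    (k : ℝ → ℝ → ℝ) (Ck : ℝ) (hCk : 0 ≤ Ck)
    (hk_meas : Measurable (Function.uncurry k))
    (hk_bdd : ∀ᵐ ts : ℝ × ℝ ∂volume,
      0 ≤ ts.2 → ts.2 ≤ ts.1 → ts.1 ≤ T → |k ts.1 ts.2| ≤ Ck)
    (u : ℝ → V) (p : ℝ → Q)
    (hu : IntervalIntegrable u volume 0 T) (hp : IntervalIntegrable p volume 0 T)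
    (heq : ∀ᵐ t ∂volume, t ∈ Set.Icc (0:ℝ) T → ∀ v : V,
      a (u t) v + b v (p t)
        = ∫ s in (0:ℝ)..t, k t s * (a (u s) v + b v (p s))) :
    ∀ᵐ t ∂volume, t ∈ Set.Icc (0:ℝ) T → ∀ v : V, a (u t) v + b v (p t) = 0 := by
  set F : ℝ → (V →L[ℝ] ℝ) := fun s => a (u s) + b.flip (p s) with hF
  have hFv : ∀ s v, F s v = a (u s) v + b v (p s) := fun s v => by simp [hF]
  have hFi : IntervalIntegrable F volume 0 T := by
    constructor
    · exact (a.integrable_comp hu.1).add (b.flip.integrable_comp hp.1)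
    · exact (a.integrable_comp hu.2).add (b.flip.integrable_comp hp.2)
  have hsec : ∀ᵐ t : ℝ ∂volume, ∀ᵐ s : ℝ ∂volume, 0 ≤ s → s ≤ t → t ≤ T → |k t s| ≤ Ck := by
    rw [Measure.volume_eq_prod] at hk_bdd
    exact Measure.ae_ae_of_ae_prod hk_bdd
  have hG : ∀ᵐ t ∂volume, t ∈ Set.Icc (0:ℝ) T → ‖F t‖ ≤ Ck * ∫ s in (0:ℝ)..t, ‖F s‖ := by
    filter_upwards [heq, hsec] with t h1 h2 ht
    have hI : IntervalIntegrable (fun s => ‖F s‖) volume 0 t := by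
      apply hFi.norm.mono_set
      rw [Set.uIcc_of_le ht.1, Set.uIcc_of_le hT.le]
      exact Set.Icc_subset_Icc_right ht.2
    have hn : 0 ≤ ∫ s in (0:ℝ)..t, ‖F s‖ :=
      intervalIntegral.integral_nonneg ht.1 (fun _ _ => norm_nonneg _)
    refine ContinuousLinearMap.opNorm_le_bound _ (mul_nonneg hCk hn) (fun v => ?_)
    rw [hFv, h1 ht v]
    have e : Ck * (∫ s in (0:ℝ)..t, ‖F s‖) * ‖v‖ = ∫ s in (0:ℝ)..t, Ck * ‖F s‖ * ‖v‖ := by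
      rw [intervalIntegral.integral_mul_const, intervalIntegral.integral_const_mul]
    rw [e]
    apply intervalIntegral.norm_integral_le_of_norm_le ht.1
    · filter_upwards [h2] with s hs hs1
      rw [← hFv, norm_mul, mul_assoc]
      exact mul_le_mul (hs hs1.1.le hs1.2 ht.2) ((F s).le_opNorm v) (norm_nonneg _) hCk
    · exact (hI.const_mul Ck).mul_const _
  have hz := gron_aux T Ck hCk (fun s => ‖F s‖) (fun _ => norm_nonneg _) hFi.norm hT hG
  filter_upwards [hG] with t h1 ht v
  have h3 : ‖F t‖ ≤ 0 := (h1 ht).trans (mul_nonpos_of_nonneg_of_nonpos hCk (hz t ht))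
  rw [← hFv, norm_le_zero_iff.1 h3]
  rfl
end

section
/- Suppose (u,p) ∈ L¹(J;V) × L¹(J;Q) satisfies, for a.e. t ∈ J, a(u(t),v) + b(v,p(t)) = 0 for all v ∈ V. Write u₀(t) = P_K u(t) and ū(t) = P_{K⊥} u(t), where P_K and P_{K⊥} are the orthogonal projections onto K = ker B and its orthogonal complement. Then for a.e. t ∈ J, ‖u₀(t)‖_V ≤ (‖a‖/α₀)^{1/2} ‖ū(t)‖_V. -/
open MeasureTheory

/-- If `(u,p)` satisfies `a(u(t),v) + b(v,p(t)) = 0` for all `v ∈ V`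
for a.e. `t ∈ J`, and `u = u₀ + ū` is the orthogonal decomposition along
`K = ker B` and `K⊥`, then `‖u₀(t)‖_V ≤ (‖a‖/α₀)^{1/2} ‖ū(t)‖_V` for a.e. `t ∈ J`. -/
theorem statement3
    {V Q : Type*} [NormedAddCommGroup V] [InnerProductSpace ℝ V] [CompleteSpace V]
    [NormedAddCommGroup Q] [InnerProductSpace ℝ Q] [CompleteSpace Q]
    (T : ℝ) (hT : 0 < T)
    (a : V →L[ℝ] V →L[ℝ] ℝ) (b : V →L[ℝ] Q →L[ℝ] ℝ)
    (ha_symm : ∀ v w : V, a v w = a w v) (ha_pos : ∀ v : V, 0 ≤ a v v)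
    (α₀ : ℝ) (hα₀ : 0 < α₀)
    (hcoer : ∀ v ∈ LinearMap.ker (b : V →ₗ[ℝ] Q →L[ℝ] ℝ), α₀ * ‖v‖ ^ 2 ≤ a v v)
    (u : ℝ → V) (p : ℝ → Q)
    (hu : IntervalIntegrable u volume 0 T) (hp : IntervalIntegrable p volume 0 T)
    (u₀ ubar : ℝ → V)
    (hdec : ∀ t : ℝ, u₀ t ∈ LinearMap.ker (b : V →ₗ[ℝ] Q →L[ℝ] ℝ) ∧ ubar t ∈ (LinearMap.ker (b : V →ₗ[ℝ] Q →L[ℝ] ℝ))ᗮ ∧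
      u t = u₀ t + ubar t)
    (heq : ∀ᵐ t ∂volume, t ∈ Set.Icc (0:ℝ) T → ∀ v : V,
      a (u t) v + b v (p t) = 0) :
    ∀ᵐ t ∂volume, t ∈ Set.Icc (0:ℝ) T →
      ‖u₀ t‖ ≤ Real.sqrt (‖a‖ / α₀) * ‖ubar t‖ := by
  filter_upwards [heq] with t ht hmem
  obtain ⟨h0, -, hsum⟩ := hdec t
  have h1 := ht hmem (u₀ t)
  have hb : b (u₀ t) = 0 := by simpa using h0
  have h2 := ha_pos (u t)
  rw [hsum] at h1 h2
  simp only [hb, map_add, ContinuousLinearMap.add_apply, ContinuousLinearMap.zero_apply,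
    add_zero] at h1 h2
  have h3 := ha_symm (u₀ t) (ubar t)
  have h4 := hcoer _ h0
  have h5 : a (ubar t) (ubar t) ≤ ‖a‖ * ‖ubar t‖ * ‖ubar t‖ :=
    (le_abs_self _).trans (a.le_opNorm₂ (ubar t) (ubar t))
  have h6 : ‖u₀ t‖ ^ 2 ≤ ‖a‖ / α₀ * ‖ubar t‖ ^ 2 := by
    rw [div_mul_eq_mul_div, le_div_iff₀ hα₀]
    nlinarith
  have h7 : 0 ≤ ‖a‖ / α₀ := by positivity
  refine (sq_le_sq₀ (by positivity) (by positivity)).1 ?_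
  rw [mul_pow, Real.sq_sqrt h7]
  exact h6
end

section
/- Suppose (u,p) ∈ L¹(J;V) × L¹(J;Q) satisfies the second equation of Problem (P): for a.e. t ∈ J and all q ∈ Q, b(u(t),q) − c(p(t),q) = ⟨g(t),q⟩ + ∫₀ᵗ [k₃(t,s) b(u(s),q) − k₄(t,s) c(p(s),q)] ds, where |k₄(t,s)| ≤ C_{k₄} a.e. on the triangle 0 ≤ s ≤ t ≤ T. Assume g₀ = 0, i.e. ⟨g(t),q⟩ = 0 for all q ∈ H for a.e. t. Then for a.e. t ∈ J, ‖p₀(t)‖_Q ≤ (‖c‖/γ₀)^{1/2} { ‖p̄(t)‖_Q + C_{k₄}[1 + e^{C_{k₄}T}(1 + C_{k₄}T)] ∫₀ᵀ ‖p̄(s)‖_Q ds }. -/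
open MeasureTheory

lemma aux_gronwall (T C : ℝ) (hT : 0 < T) (hC : 0 ≤ C) (w a : ℝ → ℝ)
    (hw0 : ∀ t, 0 ≤ w t) (ha0 : ∀ t, 0 ≤ a t)
    (hw : IntervalIntegrable w volume 0 T) (ha : IntervalIntegrable a volume 0 T)
    (h : ∀ᵐ t ∂volume, t ∈ Set.Icc (0:ℝ) T → w t ≤ a t + C * ∫ s in (0:ℝ)..t, (w s + a s)) :
    ∀ᵐ t ∂volume, t ∈ Set.Icc (0:ℝ) T →
      w t ≤ a t + C * (1 + Real.exp (C * T) * (1 + C * T)) * ∫ s in (0:ℝ)..T, a s := by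
  set A := ∫ s in (0:ℝ)..T, a s with hA
  have hsub : ∀ t ∈ Set.Icc (0:ℝ) T, Set.uIcc 0 t ⊆ Set.uIcc 0 T := by
    intro t ht
    rw [Set.uIcc_of_le ht.1, Set.uIcc_of_le hT.le]
    exact Set.Icc_subset_Icc_right ht.2
  have hwt : ∀ t ∈ Set.Icc (0:ℝ) T, IntervalIntegrable w volume 0 t :=
    fun t ht => hw.mono_set (hsub t ht)
  have hat : ∀ t ∈ Set.Icc (0:ℝ) T, IntervalIntegrable a volume 0 t :=
    fun t ht => ha.mono_set (hsub t ht)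
  have hA0 : 0 ≤ A := intervalIntegral.integral_nonneg hT.le (fun s _ => ha0 s)
  have hAt : ∀ t ∈ Set.Icc (0:ℝ) T, ∫ s in (0:ℝ)..t, a s ≤ A := fun t ht =>
    intervalIntegral.integral_mono_interval le_rfl ht.1 ht.2
      (Filter.Eventually.of_forall ha0) ha
  set w' : ℝ → ℝ := (Set.Ioc 0 T).indicator w with hw'
  have hw'i : Integrable w' volume := by
    rw [hw', integrable_indicator_iff measurableSet_Ioc]
    exact (intervalIntegrable_iff_integrableOn_Ioc_of_le hT.le).1 hw
  set W : ℝ → ℝ := fun t => ∫ s in (0:ℝ)..t, w' s with hW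
  have hWc : Continuous W := intervalIntegral.continuous_primitive (fun x y => hw'i.intervalIntegrable) 0
  have hWeq : ∀ t ∈ Set.Icc (0:ℝ) T, W t = ∫ s in (0:ℝ)..t, w s := by
    intro t ht
    apply intervalIntegral.integral_congr_ae
    refine Filter.Eventually.of_forall fun s hs => ?_
    rw [Set.uIoc_of_le ht.1] at hs
    exact Set.indicator_of_mem (show s ∈ Set.Ioc 0 T from ⟨hs.1, hs.2.trans ht.2⟩) w
  have hW0 : ∀ t ∈ Set.Icc (0:ℝ) T, 0 ≤ W t := by
    intro t ht
    rw [hWeq t ht]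
    exact intervalIntegral.integral_nonneg ht.1 (fun s _ => hw0 s)
  -- pointwise bound
  have h1 : ∀ᵐ t ∂volume, t ∈ Set.Icc (0:ℝ) T → w t ≤ a t + C * A + C * W t := by
    filter_upwards [h] with t h ht
    have := h ht
    rw [intervalIntegral.integral_add (hwt t ht) (hat t ht), ← hWeq t ht] at this
    have h3 := mul_le_mul_of_nonneg_left (hAt t ht) hC
    linarith
  set K := (1 + C * T) * A with hK
  have hK0 : 0 ≤ K := by positivity
  set Y : ℝ → ℝ := fun t => K + C * ∫ s in (0:ℝ)..t, W s with hY
  have hWY : ∀ t ∈ Set.Icc (0:ℝ) T, W t ≤ Y t := by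
    intro t ht
    have hci : IntervalIntegrable (fun s : ℝ => a s + C * A) volume 0 t :=
      (hat t ht).add intervalIntegrable_const
    have hWi : IntervalIntegrable (fun s : ℝ => C * W s) volume 0 t :=
      (hWc.intervalIntegrable _ _).const_mul C
    have : ∫ s in (0:ℝ)..t, w s ≤ ∫ s in (0:ℝ)..t, (a s + C * A + C * W s) := by
      apply intervalIntegral.integral_mono_ae_restrict ht.1 (hwt t ht) (hci.add hWi)
      rw [Filter.EventuallyLE, ae_restrict_iff' measurableSet_Icc]
      filter_upwards [h1] with s hs hst
      exact hs ⟨hst.1, hst.2.trans ht.2⟩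
    rw [intervalIntegral.integral_add hci hWi,
      intervalIntegral.integral_add (hat t ht) intervalIntegrable_const,
      intervalIntegral.integral_const, intervalIntegral.integral_const_mul] at this
    rw [hWeq t ht]
    simp only [hY, hK]
    have h4 := hAt t ht
    have h5 : t * (C * A) ≤ T * (C * A) := mul_le_mul_of_nonneg_right ht.2 (by positivity)
    simp only [smul_eq_mul, sub_zero] at this
    nlinarith
  have hYd : ∀ t, HasDerivAt Y (C * W t) t := by
    intro t
    exact ((hWc.integral_hasStrictDerivAt 0 t).hasDerivAt.const_mul C).const_add K
  have hYb : ∀ t ∈ Set.Icc (0:ℝ) T, ‖Y t‖ ≤ gronwallBound K C 0 (t - 0) := by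
    apply norm_le_gronwallBound_of_norm_deriv_right_le (f' := fun t => C * W t)
    · exact fun t _ => (hYd t).continuousAt.continuousWithinAt
    · exact fun t _ => (hYd t).hasDerivWithinAt
    · simp [hY, abs_of_nonneg hK0]
    · intro t ht
      have ht' : t ∈ Set.Icc (0:ℝ) T := ⟨ht.1, ht.2.le⟩
      rw [Real.norm_of_nonneg (mul_nonneg hC (hW0 t ht')),
        Real.norm_of_nonneg ((hW0 t ht').trans (hWY t ht')), add_zero]
      exact mul_le_mul_of_nonneg_left (hWY t ht') hC
  filter_upwards [h1] with t h1 ht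
  have h2 := hYb t ht
  rw [gronwallBound_ε0, sub_zero] at h2
  have h3 : W t ≤ K * Real.exp (C * T) := by
    refine (hWY t ht).trans ((le_abs_self _).trans (h2.trans ?_))
    have := ht.2
    gcongr
  have h4 := mul_le_mul_of_nonneg_left h3 hC
  have h5 := h1 ht
  simp only [hK] at h4
  linarith

lemma aux_cs {Q : Type*} [NormedAddCommGroup Q] [InnerProductSpace ℝ Q]
    (c : Q →L[ℝ] Q →L[ℝ] ℝ)
    (hc_symm : ∀ q r : Q, c q r = c r q) (hc_pos : ∀ q : Q, 0 ≤ c q q) (x y : Q) :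
    |c x y| ≤ Real.sqrt (c x x) * Real.sqrt (c y y) := by
  rw [← Real.sqrt_mul (hc_pos x)]
  apply Real.abs_le_sqrt
  have h : ∀ s : ℝ, 0 ≤ c x x * (s * s) + (2 * c x y) * s + c y y := by
    intro s
    have := hc_pos (s • x + y)
    simp only [map_add, map_smul, ContinuousLinearMap.add_apply, ContinuousLinearMap.smul_apply,
      smul_eq_mul, hc_symm y x] at this
    linarith
  have := discrim_le_zero h
  rw [discrim] at this
  linarith

lemma aux_int_s5 {Q : Type*} [NormedAddCommGroup Q] [InnerProductSpace ℝ Q]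
    (c : Q →L[ℝ] Q →L[ℝ] ℝ) (x : Q) :
    Real.sqrt (c x x) ≤ Real.sqrt ‖c‖ * ‖x‖ := by
  rw [← Real.sqrt_sq (norm_nonneg x), ← Real.sqrt_mul (norm_nonneg c)]
  apply Real.sqrt_le_sqrt
  have := (le_abs_self _).trans (c.le_opNorm₂ x x)
  nlinarith

lemma aux_int' {Q : Type*} [NormedAddCommGroup Q] [InnerProductSpace ℝ Q]
    (c : Q →L[ℝ] Q →L[ℝ] ℝ) (T : ℝ) (f : ℝ → Q) (hf : IntervalIntegrable f volume 0 T) :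
    IntervalIntegrable (fun t => Real.sqrt (c (f t) (f t))) volume 0 T := by
  have hcont : Continuous fun x : Q => Real.sqrt (c x x) := by fun_prop
  refine (hf.norm.const_mul (Real.sqrt ‖c‖)).mono_fun ?_ ?_
  · exact hcont.comp_aestronglyMeasurable (intervalIntegrable_iff.1 hf).aestronglyMeasurable
  · refine Filter.Eventually.of_forall fun t => ?_
    simp only [Real.norm_eq_abs]
    rw [abs_of_nonneg (Real.sqrt_nonneg _), abs_of_nonneg (by positivity)]
    exact aux_int_s5 c _

/-- If `(u,p)` satisfies the second equation of Problem (P) with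
bounded kernel `k₄` and `g₀ = 0` (i.e. `⟨g(t),q⟩ = 0` for all `q ∈ H = ker B*`),
then for a.e. `t ∈ J`,
`‖p₀(t)‖_Q ≤ (‖c‖/γ₀)^{1/2} { ‖p̄(t)‖_Q + C_{k₄}[1 + e^{C_{k₄}T}(1 + C_{k₄}T)] ∫₀ᵀ ‖p̄(s)‖_Q ds }`. -/
theorem statement5
    {V Q : Type*} [NormedAddCommGroup V] [InnerProductSpace ℝ V] [CompleteSpace V]
    [NormedAddCommGroup Q] [InnerProductSpace ℝ Q] [CompleteSpace Q]
    (T : ℝ) (hT : 0 < T)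
    (b : V →L[ℝ] Q →L[ℝ] ℝ) (c : Q →L[ℝ] Q →L[ℝ] ℝ)
    (hc_symm : ∀ q r : Q, c q r = c r q) (hc_pos : ∀ q : Q, 0 ≤ c q q)
    (γ₀ : ℝ) (hγ₀ : 0 < γ₀)
    (hcoer : ∀ q ∈ LinearMap.ker (b.flip : Q →ₗ[ℝ] V →L[ℝ] ℝ), γ₀ * ‖q‖ ^ 2 ≤ c q q)
    (k₃ k₄ : ℝ → ℝ → ℝ) (Ck₄ : ℝ) (hCk₄ : 0 ≤ Ck₄)
    (hk₃_meas : Measurable (Function.uncurry k₃))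
    (hk₄_meas : Measurable (Function.uncurry k₄))
    (hk₄_bdd : ∀ᵐ ts : ℝ × ℝ ∂volume,
      0 ≤ ts.2 → ts.2 ≤ ts.1 → ts.1 ≤ T → |k₄ ts.1 ts.2| ≤ Ck₄)
    (u : ℝ → V) (p : ℝ → Q) (g : ℝ → Q →L[ℝ] ℝ)
    (hu : IntervalIntegrable u volume 0 T) (hp : IntervalIntegrable p volume 0 T)
    (hg : IntervalIntegrable g volume 0 T)
    (p₀ pbar : ℝ → Q)
    (hdec : ∀ t : ℝ, p₀ t ∈ LinearMap.ker (b.flip : Q →ₗ[ℝ] V →L[ℝ] ℝ) ∧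
      pbar t ∈ (LinearMap.ker (b.flip : Q →ₗ[ℝ] V →L[ℝ] ℝ))ᗮ ∧ p t = p₀ t + pbar t)
    (hg₀ : ∀ᵐ t ∂volume, t ∈ Set.Icc (0:ℝ) T →
      ∀ q ∈ LinearMap.ker (b.flip : Q →ₗ[ℝ] V →L[ℝ] ℝ), g t q = 0)
    (heq : ∀ᵐ t ∂volume, t ∈ Set.Icc (0:ℝ) T → ∀ q : Q,
      b (u t) q - c (p t) q
        = g t q + ∫ s in (0:ℝ)..t, (k₃ t s * b (u s) q - k₄ t s * c (p s) q)) :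
    ∀ᵐ t ∂volume, t ∈ Set.Icc (0:ℝ) T →
      ‖p₀ t‖ ≤ Real.sqrt (‖c‖ / γ₀) *
        (‖pbar t‖ + Ck₄ * (1 + Real.exp (Ck₄ * T) * (1 + Ck₄ * T)) *
          ∫ s in (0:ℝ)..T, ‖pbar s‖) := by
  set H : Submodule ℝ Q := LinearMap.ker (b.flip : Q →ₗ[ℝ] V →L[ℝ] ℝ) with hH
  have hHc : IsClosed (H : Set Q) := b.flip.isClosed_ker
  haveI : CompleteSpace H := hHc.completeSpace_coe
  have hp₀eq : p₀ = fun t => H.starProjection (p t) := by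
    funext t
    exact (Submodule.eq_starProjection_of_mem_orthogonal' (hdec t).1 (hdec t).2.1 (hdec t).2.2).symm
  have hp₀i : IntervalIntegrable p₀ volume 0 T := by
    rw [hp₀eq]
    exact ⟨H.starProjection.integrable_comp hp.1, H.starProjection.integrable_comp hp.2⟩
  have hpbi : IntervalIntegrable pbar volume 0 T := by
    have : pbar = fun t => p t - p₀ t := by
      funext t; rw [(hdec t).2.2]; simp
    rw [this]
    exact hp.sub hp₀i
  set w : ℝ → ℝ := fun t => Real.sqrt (c (p₀ t) (p₀ t)) with hw
  set a : ℝ → ℝ := fun t => Real.sqrt (c (pbar t) (pbar t)) with ha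
  have hwi : IntervalIntegrable w volume 0 T := aux_int' c T p₀ hp₀i
  have hai : IntervalIntegrable a volume 0 T := aux_int' c T pbar hpbi
  have hw0 : ∀ t, 0 ≤ w t := fun t => Real.sqrt_nonneg _
  have ha0 : ∀ t, 0 ≤ a t := fun t => Real.sqrt_nonneg _
  have hk : ∀ᵐ t : ℝ ∂volume, ∀ᵐ s : ℝ ∂volume, 0 ≤ s → s ≤ t → t ≤ T → |k₄ t s| ≤ Ck₄ := by
    rw [Measure.volume_eq_prod] at hk₄_bdd
    exact Measure.ae_ae_of_ae_prod hk₄_bdd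
  have hbH : ∀ v : V, ∀ q ∈ H, b v q = 0 := by
    intro v q hq
    have h1 : b.flip q = 0 := hq
    rw [← ContinuousLinearMap.flip_apply, h1]; rfl
  have key : ∀ᵐ t ∂volume, t ∈ Set.Icc (0:ℝ) T →
      w t ≤ a t + Ck₄ * ∫ s in (0:ℝ)..t, (w s + a s) := by
    filter_upwards [hk, hg₀, heq] with t hk hg₀ heq ht
    have hqH := (hdec t).1
    have e := heq ht (p₀ t)
    rw [hg₀ ht _ hqH, hbH _ _ hqH] at e
    have hbd : ‖∫ s in (0:ℝ)..t, (k₃ t s * b (u s) (p₀ t) - k₄ t s * c (p s) (p₀ t))‖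
        ≤ ∫ s in (0:ℝ)..t, (Ck₄ * w t) * (w s + a s) := by
      apply intervalIntegral.norm_integral_le_of_norm_le ht.1
      · filter_upwards [hk] with s hs hst
        have hs' := hs hst.1.le hst.2 ht.2
        rw [hbH _ _ hqH, mul_zero, zero_sub, norm_neg, norm_mul, Real.norm_eq_abs,
          Real.norm_eq_abs, mul_assoc]
        have : |c (p s) (p₀ t)| ≤ w t * (w s + a s) := by
          rw [(hdec s).2.2, map_add, ContinuousLinearMap.add_apply]
          refine (abs_add_le _ _).trans ?_
          have h1 := aux_cs c hc_symm hc_pos (p₀ s) (p₀ t)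
          have h2 := aux_cs c hc_symm hc_pos (pbar s) (p₀ t)
          simp only [hw, ha]
          linarith
        exact mul_le_mul hs' this (abs_nonneg _) hCk₄
      · apply IntervalIntegrable.const_mul
        apply (hwi.add hai).mono_set
        rw [Set.uIcc_of_le ht.1, Set.uIcc_of_le hT.le]
        exact Set.Icc_subset_Icc_right ht.2
    rw [intervalIntegral.integral_const_mul, Real.norm_eq_abs] at hbd
    set I := ∫ s in (0:ℝ)..t, (w s + a s) with hI
    have hI0 : 0 ≤ I :=
      intervalIntegral.integral_nonneg ht.1 (fun s _ => add_nonneg (hw0 s) (ha0 s))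
    have hbd' := neg_le_of_abs_le hbd
    have h2 := neg_le_of_abs_le (aux_cs c hc_symm hc_pos (pbar t) (p₀ t))
    have h3 : w t * w t = c (p₀ t) (p₀ t) := Real.mul_self_sqrt (hc_pos _)
    have h4 : c (p t) (p₀ t) = c (p₀ t) (p₀ t) + c (pbar t) (p₀ t) := by
      rw [(hdec t).2.2, map_add, ContinuousLinearMap.add_apply]
    have h5 : w t * w t ≤ w t * (a t + Ck₄ * I) := by
      have h2' : -(a t * w t) ≤ c (pbar t) (p₀ t) := h2
      linarith
    rcases (hw0 t).eq_or_lt with h0 | h0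
    · rw [← h0]
      have := ha0 t
      positivity
    · exact le_of_mul_le_mul_left h5 h0
  have hA : ∫ s in (0:ℝ)..T, a s ≤ Real.sqrt ‖c‖ * ∫ s in (0:ℝ)..T, ‖pbar s‖ := by
    rw [← intervalIntegral.integral_const_mul]
    exact intervalIntegral.integral_mono_on hT.le hai (hpbi.norm.const_mul _)
      (fun s _ => aux_int_s5 c _)
  filter_upwards [aux_gronwall T Ck₄ hT hCk₄ w a hw0 ha0 hwi hai key] with t h ht
  have h1 := h ht
  have h2 : Real.sqrt γ₀ * ‖p₀ t‖ ≤ w t := by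
    rw [← Real.sqrt_sq (norm_nonneg (p₀ t)), ← Real.sqrt_mul hγ₀.le]
    exact Real.sqrt_le_sqrt (by simpa [Real.sqrt_sq (norm_nonneg (p₀ t))] using hcoer _ (hdec t).1)
  have h3 : a t ≤ Real.sqrt ‖c‖ * ‖pbar t‖ := aux_int_s5 c _
  have hD : 0 ≤ Ck₄ * (1 + Real.exp (Ck₄ * T) * (1 + Ck₄ * T)) := by positivity
  have h4 := mul_le_mul_of_nonneg_left hA hD
  rw [Real.sqrt_div (norm_nonneg c), div_mul_eq_mul_div, le_div_iff₀ (Real.sqrt_pos.2 hγ₀)]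
  linarith
end

section
/- Suppose (u,p) ∈ L¹(J;V) × L¹(J;Q) satisfies the second equation of Problem (P): for a.e. t ∈ J and all q ∈ Q, b(u(t),q) − c(p(t),q) = ⟨g(t),q⟩ + ∫₀ᵗ [k₃(t,s) b(u(s),q) − k₄(t,s) c(p(s),q)] ds, where |k₄(t,s)| ≤ C_{k₄} a.e. on the triangle 0 ≤ s ≤ t ≤ T (g ∈ L¹(J;Q') arbitrary). Then for a.e. t ∈ J, ‖p₀(t)‖_Q ≤ (1/γ₀)‖g₀(t)‖_{Q'} + (C_{k₄}‖c‖^{1/2}/γ₀^{1/2}) ∫₀ᵗ (‖p₀(s)‖_Q + ‖p̄(s)‖_Q) ds + (‖c‖/γ₀)^{1/2} ‖p̄(t)‖_Q. -/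
open MeasureTheory

/-- If `(u,p)` satisfies the second equation of Problem (P) with
bounded kernel `k₄` (and arbitrary `g ∈ L¹(J;Q')`), then for a.e. `t ∈ J`,
`‖p₀(t)‖ ≤ γ₀⁻¹‖g₀(t)‖ + (C_{k₄}‖c‖^{1/2}/γ₀^{1/2}) ∫₀ᵗ (‖p₀‖+‖p̄‖) + (‖c‖/γ₀)^{1/2}‖p̄(t)‖`. -/
theorem statement6
    {V Q : Type*} [NormedAddCommGroup V] [InnerProductSpace ℝ V] [CompleteSpace V]
    [NormedAddCommGroup Q] [InnerProductSpace ℝ Q] [CompleteSpace Q]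
    (T : ℝ) (hT : 0 < T)
    (b : V →L[ℝ] Q →L[ℝ] ℝ) (c : Q →L[ℝ] Q →L[ℝ] ℝ)
    (hc_symm : ∀ q r : Q, c q r = c r q) (hc_pos : ∀ q : Q, 0 ≤ c q q)
    (γ₀ : ℝ) (hγ₀ : 0 < γ₀)
    (hcoer : ∀ q ∈ LinearMap.ker (b.flip : Q →ₗ[ℝ] V →L[ℝ] ℝ), γ₀ * ‖q‖ ^ 2 ≤ c q q)
    (k₃ k₄ : ℝ → ℝ → ℝ) (Ck₄ : ℝ) (hCk₄ : 0 ≤ Ck₄)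
    (hk₃_meas : Measurable (Function.uncurry k₃))
    (hk₄_meas : Measurable (Function.uncurry k₄))
    (hk₄_bdd : ∀ᵐ ts : ℝ × ℝ ∂volume,
      0 ≤ ts.2 → ts.2 ≤ ts.1 → ts.1 ≤ T → |k₄ ts.1 ts.2| ≤ Ck₄)
    (u : ℝ → V) (p : ℝ → Q) (g : ℝ → Q →L[ℝ] ℝ)
    (hu : IntervalIntegrable u volume 0 T) (hp : IntervalIntegrable p volume 0 T)
    (hg : IntervalIntegrable g volume 0 T)
    (p₀ pbar : ℝ → Q)
    (hdec : ∀ t : ℝ, p₀ t ∈ LinearMap.ker (b.flip : Q →ₗ[ℝ] V →L[ℝ] ℝ) ∧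
      pbar t ∈ (LinearMap.ker (b.flip : Q →ₗ[ℝ] V →L[ℝ] ℝ))ᗮ ∧ p t = p₀ t + pbar t)
    (g₀ : ℝ → Q →L[ℝ] ℝ)
    (hg₀ : ∀ t : ℝ, (∀ q ∈ LinearMap.ker (b.flip : Q →ₗ[ℝ] V →L[ℝ] ℝ), g₀ t q = g t q) ∧
      (∀ q ∈ (LinearMap.ker (b.flip : Q →ₗ[ℝ] V →L[ℝ] ℝ))ᗮ, g₀ t q = 0))
    (heq : ∀ᵐ t ∂volume, t ∈ Set.Icc (0:ℝ) T → ∀ q : Q,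
      b (u t) q - c (p t) q
        = g t q + ∫ s in (0:ℝ)..t, (k₃ t s * b (u s) q - k₄ t s * c (p s) q)) :
    ∀ᵐ t ∂volume, t ∈ Set.Icc (0:ℝ) T →
      ‖p₀ t‖ ≤ (1 / γ₀) * ‖g₀ t‖
        + (Ck₄ * Real.sqrt ‖c‖ / Real.sqrt γ₀) *
            (∫ s in (0:ℝ)..t, (‖p₀ s‖ + ‖pbar s‖))
        + Real.sqrt (‖c‖ / γ₀) * ‖pbar t‖ := by
  have hclosed : IsClosed ((LinearMap.ker (b.flip : Q →ₗ[ℝ] V →L[ℝ] ℝ) : Submodule ℝ Q) : Set Q) :=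
    ContinuousLinearMap.isClosed_ker b.flip
  have hker : ∀ q ∈ LinearMap.ker (b.flip : Q →ₗ[ℝ] V →L[ℝ] ℝ), ∀ v, b v q = 0 := by
    intro q hq v
    have h1 : b.flip q = 0 := hq
    have h2 := congrArg (fun f : V →L[ℝ] ℝ => f v) h1
    simpa using h2
  generalize LinearMap.ker (b.flip : Q →ₗ[ℝ] V →L[ℝ] ℝ) = H at *
  haveI : CompleteSpace H := hclosed.completeSpace_coe
  have hp0 : p₀ = fun t => H.starProjection (p t) := by
    funext t
    obtain ⟨h1, h2, h3⟩ := hdec t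
    symm
    apply Submodule.eq_starProjection_of_mem_orthogonal h1
    rw [h3, add_sub_cancel_left]
    exact h2
  have hip0 : IntervalIntegrable p₀ volume 0 T := by
    rw [hp0, intervalIntegrable_iff]
    exact H.starProjection.integrable_comp ((intervalIntegrable_iff).1 hp)
  have hipb : IntervalIntegrable pbar volume 0 T := by
    have : pbar = fun t => p t - p₀ t := by
      funext t
      rw [(hdec t).2.2, add_sub_cancel_left]
    rw [this]
    exact hp.sub hip0
  have hiN : IntervalIntegrable (fun s => ‖p₀ s‖ + ‖pbar s‖) volume 0 T :=
    hip0.norm.add hipb.norm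
  -- Cauchy-Schwarz
  have hCS : ∀ a q : Q, |c a q| ≤ Real.sqrt ‖c‖ * ‖a‖ * Real.sqrt (c q q) := by
    intro a q
    have h1 : (c a q) ^ 2 ≤ c a a * c q q := by
      have hd : discrim (c q q) (2 * c a q) (c a a) ≤ 0 := by
        apply discrim_le_zero
        intro x
        have := hc_pos (a + x • q)
        simp only [map_add, map_smul, ContinuousLinearMap.add_apply,
          ContinuousLinearMap.smul_apply, smul_eq_mul] at this
        rw [hc_symm q a] at this
        nlinarith
      unfold discrim at hd
      nlinarith
    have h2 : c a a ≤ ‖c‖ * ‖a‖ ^ 2 := by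
      have := c.le_opNorm₂ a a
      have h3 := le_abs_self (c a a)
      rw [Real.norm_eq_abs] at this
      nlinarith
    apply abs_le_of_sq_le_sq _ (by positivity)
    rw [mul_pow, mul_pow, Real.sq_sqrt (norm_nonneg c), Real.sq_sqrt (hc_pos q)]
    exact h1.trans (mul_le_mul_of_nonneg_right h2 (hc_pos q))
  have hk : ∀ᵐ t : ℝ, ∀ᵐ s : ℝ, 0 ≤ s → s ≤ t → t ≤ T → |k₄ t s| ≤ Ck₄ :=
    Measure.ae_ae_of_ae_prod hk₄_bdd
  filter_upwards [heq, hk] with t ht hkt htT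
  obtain ⟨h1, h2, h3⟩ := hdec t
  have e := ht htT (p₀ t)
  simp only [hker _ h1, mul_zero, zero_sub] at e
  set X := Real.sqrt (c (p₀ t) (p₀ t)) with hX
  have hXX : X ^ 2 = c (p₀ t) (p₀ t) := Real.sq_sqrt (hc_pos _)
  have hX0 : 0 ≤ X := Real.sqrt_nonneg _
  set I := ∫ s in (0:ℝ)..t, (‖p₀ s‖ + ‖pbar s‖) with hI
  have hI0 : 0 ≤ I := intervalIntegral.integral_nonneg htT.1 (fun s _ => by positivity)
  have hint : |∫ s in (0:ℝ)..t, -(k₄ t s * c (p s) (p₀ t))| ≤ Ck₄ * Real.sqrt ‖c‖ * X * I := by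
    rw [hI, ← intervalIntegral.integral_const_mul, ← Real.norm_eq_abs]
    apply intervalIntegral.norm_integral_le_of_norm_le htT.1
    · filter_upwards [hkt] with s hs hst
      have hb := hs hst.1.le hst.2 htT.2
      rw [norm_neg, Real.norm_eq_abs, abs_mul]
      have hn : ‖p s‖ ≤ ‖p₀ s‖ + ‖pbar s‖ := by
        rw [(hdec s).2.2]; exact norm_add_le _ _
      calc |k₄ t s| * |c (p s) (p₀ t)| 
          ≤ Ck₄ * (Real.sqrt ‖c‖ * (‖p₀ s‖ + ‖pbar s‖) * X) := by
            apply mul_le_mul hb _ (abs_nonneg _) hCk₄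
            refine (hCS _ _).trans ?_
            gcongr
        _ = _ := by ring
    · apply IntervalIntegrable.const_mul
      apply hiN.mono_set
      rw [Set.uIcc_of_le htT.1, Set.uIcc_of_le hT.le]
      exact Set.Icc_subset_Icc_right htT.2
  have hγs : 0 < Real.sqrt γ₀ := Real.sqrt_pos.2 hγ₀
  have hγγ : Real.sqrt γ₀ ^ 2 = γ₀ := Real.sq_sqrt hγ₀.le
  have hpX : Real.sqrt γ₀ * ‖p₀ t‖ ≤ X := by
    apply Real.le_sqrt_of_sq_le
    rw [mul_pow, hγγ]
    exact hcoer _ h1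
  have hgb : |g t (p₀ t)| ≤ ‖g₀ t‖ * (X / Real.sqrt γ₀) := by
    rw [← (hg₀ t).1 _ h1, ← Real.norm_eq_abs]
    refine ((g₀ t).le_opNorm _).trans ?_
    gcongr
    rw [le_div_iff₀ hγs]; linarith
  have hpb := hCS (pbar t) (p₀ t)
  rw [← hX] at hpb
  have hsplit : c (p t) (p₀ t) = c (p₀ t) (p₀ t) + c (pbar t) (p₀ t) := by
    rw [h3]; simp
  set R := Real.sqrt ‖c‖ * ‖pbar t‖ + ‖g₀ t‖ / Real.sqrt γ₀ + Ck₄ * Real.sqrt ‖c‖ * I with hR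
  have hR0 : 0 ≤ R := by positivity
  have hmain : X ^ 2 ≤ R * X := by
    have a1 := neg_abs_le (∫ s in (0:ℝ)..t, -(k₄ t s * c (p s) (p₀ t)))
    have a2 := neg_abs_le (g t (p₀ t))
    have a3 := neg_abs_le (c (pbar t) (p₀ t))
    have : R * X = Real.sqrt ‖c‖ * ‖pbar t‖ * X + ‖g₀ t‖ * (X / Real.sqrt γ₀)
        + Ck₄ * Real.sqrt ‖c‖ * X * I := by rw [hR]; ring
    rw [this, hXX]
    linarith
  have hXR : X ≤ R := by
    rcases hX0.eq_or_lt with h | h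
    · rw [← h]; exact hR0
    · rw [sq] at hmain
      exact le_of_mul_le_mul_right hmain h
  have hfin : ‖p₀ t‖ ≤ R / Real.sqrt γ₀ := by
    rw [le_div_iff₀ hγs]; linarith
  refine hfin.trans (le_of_eq ?_)
  rw [hR, Real.sqrt_div (norm_nonneg c)]
  have h1γ : 1 / γ₀ = 1 / Real.sqrt γ₀ ^ 2 := by rw [hγγ]
  rw [h1γ]
  field_simp
  ring
end

section
/- Suppose (u,p) solves Problem (P) with f = 0, with equal first-equation kernels k₁ = k₂ = k (|k(t,s)| ≤ C_k a.e. on the triangle) and k₃ = k₄ ≡ 0, assume the inf-sup condition with constant β > 0 (‖B*q‖_{V'} ≥ β‖q‖_Q for all q ∈ H⊥ and ‖Bv‖_{Q'} ≥ β‖v‖_V for all v ∈ K⊥), and assume g₀ = 0 (⟨g(t),q⟩ = 0 for all q ∈ H, a.e. t). Then for a.e. t ∈ J, ‖ū(t)‖_V ≤ ((μ + β)/β²) ‖ḡ(t)‖_{Q'}, where μ = (‖a‖ ‖c‖)^{1/2}. -/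
open MeasureTheory

theorem aux_cs_s7 {V : Type*} [NormedAddCommGroup V] [NormedSpace ℝ V]
    (a : V →L[ℝ] V →L[ℝ] ℝ) (hs : ∀ v w : V, a v w = a w v) (hp : ∀ v : V, 0 ≤ a v v) (u : V) :
    ‖a u‖ ≤ Real.sqrt ‖a‖ * Real.sqrt (a u u) := by
  refine ContinuousLinearMap.opNorm_le_bound _ (by positivity) fun v => ?_
  have h1 : (a u v) ^ 2 ≤ a u u * a v v := by
    have h := discrim_le_zero (a := a v v) (b := 2 * a u v) (c := a u u) (fun x => by
      have := hp (u + x • v)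
      simp only [map_add, map_smul, ContinuousLinearMap.add_apply, ContinuousLinearMap.smul_apply,
        smul_eq_mul, hs v u] at this
      nlinarith)
    unfold discrim at h
    nlinarith
  have h2 : a v v ≤ ‖a‖ * ‖v‖ * ‖v‖ :=
    (le_abs_self _).trans (a.le_opNorm₂ v v)
  have h3 : (a u v) ^ 2 ≤ (Real.sqrt ‖a‖ * Real.sqrt (a u u) * ‖v‖) ^ 2 := by
    rw [mul_pow, mul_pow, Real.sq_sqrt (norm_nonneg a), Real.sq_sqrt (hp u)]
    nlinarith [mul_le_mul_of_nonneg_left h2 (hp u)]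
  exact abs_le_of_sq_le_sq h3 (by positivity)

theorem aux_gronwall_s7 (T C : ℝ) (hC : 0 ≤ C) (φ : ℝ → ℝ) (hφ : Integrable φ) (h0 : ∀ t, 0 ≤ φ t)
    (h : ∀ᵐ t, t ∈ Set.Icc (0:ℝ) T → φ t ≤ C * ∫ s in (0:ℝ)..t, φ s) :
    ∀ᵐ t, t ∈ Set.Icc (0:ℝ) T → φ t ≤ 0 := by
  set F : ℝ → ℝ := fun t => ∫ s in (0:ℝ)..t, φ s with hF
  have hFc : Continuous F :=
    intervalIntegral.continuous_primitive (fun _ _ => hφ.intervalIntegrable) 0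
  have hF0 : ∀ t, 0 ≤ t → 0 ≤ F t := fun t ht =>
    intervalIntegral.integral_nonneg ht (fun s _ => h0 s)
  have hle : ∀ t ∈ Set.Icc (0:ℝ) T, F t ≤ C * ∫ s in (0:ℝ)..t, F s := by
    intro t ht
    rw [← intervalIntegral.integral_const_mul]
    refine intervalIntegral.integral_mono_ae_restrict ht.1 hφ.intervalIntegrable
      ((hFc.const_mul C).intervalIntegrable _ _) ?_
    refine (ae_restrict_iff' measurableSet_Icc).2 ?_
    filter_upwards [h] with s hs hst
    exact hs ⟨hst.1, hst.2.trans ht.2⟩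
  have hΦ : ∀ t, HasDerivAt (fun t => ∫ s in (0:ℝ)..t, F s) (F t) t := fun t =>
    hFc.integral_hasStrictDerivAt 0 t |>.hasDerivAt
  have hz : ∀ t ∈ Set.Icc (0:ℝ) T, ‖∫ s in (0:ℝ)..t, F s‖ ≤ gronwallBound 0 C 0 (t - 0) := by
    refine norm_le_gronwallBound_of_norm_deriv_right_le (f' := F)
      (fun t _ => (hΦ t).continuousAt.continuousWithinAt)
      (fun t _ => (hΦ t).hasDerivWithinAt) (by simp) ?_
    intro t ht
    rw [Real.norm_of_nonneg (hF0 t ht.1), Real.norm_of_nonneg, add_zero]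
    · exact hle t ⟨ht.1, ht.2.le⟩
    · exact intervalIntegral.integral_nonneg ht.1 (fun s hs => hF0 s hs.1)
  filter_upwards [h] with t ht hm
  have h1 := hz t hm
  rw [gronwallBound_ε0_δ0, norm_le_zero_iff] at h1
  have h2 := hle t hm
  rw [h1, mul_zero] at h2
  exact (ht hm).trans (mul_nonpos_of_nonneg_of_nonpos hC h2)

theorem aux_static {V Q : Type*} [NormedAddCommGroup V] [InnerProductSpace ℝ V]
    [NormedAddCommGroup Q] [InnerProductSpace ℝ Q] [CompleteSpace Q]
    (a : V →L[ℝ] V →L[ℝ] ℝ) (b : V →L[ℝ] Q →L[ℝ] ℝ) (c : Q →L[ℝ] Q →L[ℝ] ℝ)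
    (ha_symm : ∀ v w : V, a v w = a w v) (ha_pos : ∀ v : V, 0 ≤ a v v)
    (hc_symm : ∀ q r : Q, c q r = c r q) (hc_pos : ∀ q : Q, 0 ≤ c q q)
    (β : ℝ) (hβ : 0 < β)
    (hinfsupQ : ∀ q ∈ (LinearMap.ker b.flip.toLinearMap)ᗮ, β * ‖q‖ ≤ ‖b.flip q‖)
    (hinfsupV : ∀ v ∈ (LinearMap.ker b.toLinearMap)ᗮ, β * ‖v‖ ≤ ‖b v‖)
    (u u₀ ubar : V) (p : Q) (g gbar : Q →L[ℝ] ℝ)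
    (h1 : a u + b.flip p = 0) (h2 : ∀ q : Q, b u q - c p q = g q)
    (hg0 : ∀ q ∈ LinearMap.ker b.flip.toLinearMap, g q = 0)
    (hu₀ : u₀ ∈ LinearMap.ker b.toLinearMap) (hub : ubar ∈ (LinearMap.ker b.toLinearMap)ᗮ)
    (hu : u = u₀ + ubar)
    (hgb1 : ∀ q ∈ (LinearMap.ker b.flip.toLinearMap)ᗮ, gbar q = g q)
    (hgb2 : ∀ q ∈ LinearMap.ker b.flip.toLinearMap, gbar q = 0) :
    ‖ubar‖ ≤ ((Real.sqrt (‖a‖ * ‖c‖) + β) / β ^ 2) * ‖gbar‖ := by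
  have hcl : IsClosed (LinearMap.ker b.flip.toLinearMap : Set Q) := b.flip.isClosed_ker
  haveI : CompleteSpace (LinearMap.ker b.flip.toLinearMap) := hcl.completeSpace_coe
  have hsplit : ∀ q : Q, ∃ y ∈ LinearMap.ker b.flip.toLinearMap,
      ∃ z ∈ (LinearMap.ker b.flip.toLinearMap)ᗮ, q = y + z := fun q =>
    (LinearMap.ker b.flip.toLinearMap).exists_add_mem_mem_orthogonal q
  have hgg : gbar = g := by
    ext q
    obtain ⟨y, hy, z, hz, rfl⟩ := hsplit q
    rw [map_add, map_add, hgb1 z hz, hgb2 y hy, hg0 y hy]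
  subst hgg
  obtain ⟨y, hy, z, hz, hpz⟩ := hsplit p
  have hbp : b.flip p = b.flip z := by
    have : b.flip y = 0 := hy
    rw [hpz, map_add, this, zero_add]
  have hbu : b u = b ubar := by
    have : b u₀ = 0 := hu₀
    rw [hu, map_add, this, zero_add]
  have ca := aux_cs_s7 a ha_symm ha_pos u
  have cc := aux_cs_s7 c hc_symm hc_pos p
  have e1 : β * ‖z‖ ≤ Real.sqrt ‖a‖ * Real.sqrt (a u u) := by
    refine (hinfsupQ z hz).trans ?_
    rw [← hbp, ← neg_eq_of_add_eq_zero_right h1, norm_neg]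
    exact ca
  have e2 : β * ‖ubar‖ ≤ ‖gbar‖ + Real.sqrt ‖c‖ * Real.sqrt (c p p) := by
    refine (hinfsupV _ hub).trans ?_
    have : b ubar = gbar + c p := by
      rw [← hbu]; ext q
      have := h2 q
      simp only [ContinuousLinearMap.add_apply]; linarith
    rw [this]
    exact (norm_add_le _ _).trans (by linarith)
  have e3 : a u u + c p p ≤ ‖gbar‖ * ‖z‖ := by
    have i1 : a u u + b u p = 0 := by
      have := congrArg (fun f => f u) h1
      simpa using this
    have i2 := h2 p
    have i3 : gbar p = gbar z := by rw [hpz, map_add, hg0 y hy, zero_add]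
    have i4 := gbar.le_opNorm z
    have i5 := neg_abs_le (gbar z)
    rw [Real.norm_eq_abs] at i4
    linarith
  have sx := Real.sq_sqrt (ha_pos u)
  have sy := Real.sq_sqrt (hc_pos p)
  rw [Real.sqrt_mul (norm_nonneg a)]
  have hx := Real.sqrt_nonneg (a u u)
  have hyy := Real.sqrt_nonneg (c p p)
  have hA := Real.sqrt_nonneg ‖a‖
  have hC := Real.sqrt_nonneg ‖c‖
  have hG := norm_nonneg gbar
  generalize Real.sqrt (a u u) = X at *
  generalize Real.sqrt (c p p) = Y at *
  generalize Real.sqrt ‖a‖ = A at *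
  generalize Real.sqrt ‖c‖ = D at *
  generalize ‖gbar‖ = G at *
  have f1 : β * (X ^ 2 + Y ^ 2) ≤ G * (A * X) := by
    calc β * (X ^ 2 + Y ^ 2) ≤ β * (G * ‖z‖) := by rw [sx, sy]; gcongr
      _ = G * (β * ‖z‖) := by ring
      _ ≤ _ := by gcongr
  have f2 : β * Y ≤ G * A := by
    refine abs_le_of_sq_le_sq' ?_ (by positivity) |>.2
    have := mul_le_mul_of_nonneg_left f1 hβ.le
    nlinarith [sq_nonneg (β * X - G * A), sq_nonneg (β * X), sq_nonneg (G * A)]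
  have f3 : β * (β * ‖ubar‖) ≤ (A * D + β) * G := by
    have := mul_le_mul_of_nonneg_left e2 hβ.le
    have := mul_le_mul_of_nonneg_left f2 hC
    nlinarith
  rw [div_mul_eq_mul_div, le_div_iff₀ (by positivity)]
  linarith

/-- Suppose `(u,p)` solves Problem (P) with `f = 0`, with equal
first-equation kernels `k₁ = k₂ = k` and `k₃ = k₄ ≡ 0`, the inf-sup conditions with
constant `β > 0` hold, and `g₀ = 0`. Then for a.e. `t ∈ J`,
`‖ū(t)‖_V ≤ ((μ + β)/β²) ‖ḡ(t)‖_{Q'}` with `μ = (‖a‖‖c‖)^{1/2}`. -/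
theorem statement7
    {V Q : Type*} [NormedAddCommGroup V] [InnerProductSpace ℝ V] [CompleteSpace V]
    [NormedAddCommGroup Q] [InnerProductSpace ℝ Q] [CompleteSpace Q]
    (T : ℝ) (hT : 0 < T)
    (a : V →L[ℝ] V →L[ℝ] ℝ) (b : V →L[ℝ] Q →L[ℝ] ℝ) (c : Q →L[ℝ] Q →L[ℝ] ℝ)
    (ha_symm : ∀ v w : V, a v w = a w v) (ha_pos : ∀ v : V, 0 ≤ a v v)
    (hc_symm : ∀ q r : Q, c q r = c r q) (hc_pos : ∀ q : Q, 0 ≤ c q q)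
    (β : ℝ) (hβ : 0 < β)
    (hinfsupQ : ∀ q ∈ (LinearMap.ker b.flip.toLinearMap)ᗮ, β * ‖q‖ ≤ ‖b.flip q‖)
    (hinfsupV : ∀ v ∈ (LinearMap.ker b.toLinearMap)ᗮ, β * ‖v‖ ≤ ‖b v‖)
    (k : ℝ → ℝ → ℝ) (Ck : ℝ) (hCk : 0 ≤ Ck)
    (hk_meas : Measurable (Function.uncurry k))
    (hk_bdd : ∀ᵐ ts : ℝ × ℝ ∂volume,
      0 ≤ ts.2 → ts.2 ≤ ts.1 → ts.1 ≤ T → |k ts.1 ts.2| ≤ Ck)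
    (u : ℝ → V) (p : ℝ → Q) (g : ℝ → Q →L[ℝ] ℝ)
    (hu : IntervalIntegrable u volume 0 T) (hp : IntervalIntegrable p volume 0 T)
    (hg : IntervalIntegrable g volume 0 T)
    (heq1 : ∀ᵐ t ∂volume, t ∈ Set.Icc (0:ℝ) T → ∀ v : V,
      a (u t) v + b v (p t)
        = ∫ s in (0:ℝ)..t, k t s * (a (u s) v + b v (p s)))
    (heq2 : ∀ᵐ t ∂volume, t ∈ Set.Icc (0:ℝ) T → ∀ q : Q,
      b (u t) q - c (p t) q = g t q)
    (hg₀ : ∀ᵐ t ∂volume, t ∈ Set.Icc (0:ℝ) T →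
      ∀ q ∈ LinearMap.ker b.flip.toLinearMap, g t q = 0)
    (u₀ ubar : ℝ → V)
    (hdec : ∀ t : ℝ, u₀ t ∈ LinearMap.ker b.toLinearMap ∧ ubar t ∈ (LinearMap.ker b.toLinearMap)ᗮ ∧
      u t = u₀ t + ubar t)
    (gbar : ℝ → Q →L[ℝ] ℝ)
    (hgbar : ∀ t : ℝ, (∀ q ∈ (LinearMap.ker b.flip.toLinearMap)ᗮ, gbar t q = g t q) ∧
      (∀ q ∈ LinearMap.ker b.flip.toLinearMap, gbar t q = 0)) :
    ∀ᵐ t ∂volume, t ∈ Set.Icc (0:ℝ) T →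
      ‖ubar t‖ ≤ ((Real.sqrt (‖a‖ * ‖c‖) + β) / β ^ 2) * ‖gbar t‖ := by
  set L : ℝ → V →L[ℝ] ℝ := fun s => a (u s) + b.flip (p s) with hL
  have hu' : IntegrableOn u (Set.Icc 0 T) := (intervalIntegrable_iff_integrableOn_Icc_of_le hT.le).1 hu
  have hp' : IntegrableOn p (Set.Icc 0 T) := (intervalIntegrable_iff_integrableOn_Icc_of_le hT.le).1 hp
  have hLi : IntegrableOn L (Set.Icc 0 T) :=
    (a.integrable_comp hu').add (b.flip.integrable_comp hp')
  set φ : ℝ → ℝ := (Set.Icc 0 T).indicator (fun s => ‖L s‖) with hφd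
  have hφ : Integrable φ := (integrable_indicator_iff measurableSet_Icc).2 hLi.norm
  have hφ0 : ∀ t, 0 ≤ φ t := fun t => Set.indicator_nonneg (fun _ _ => norm_nonneg _) t
  have hk2 : ∀ᵐ t : ℝ, ∀ᵐ s : ℝ, 0 ≤ s → s ≤ t → t ≤ T → |k t s| ≤ Ck :=
    Measure.ae_ae_of_ae_prod hk_bdd
  have hkey : ∀ᵐ t, t ∈ Set.Icc (0:ℝ) T → φ t ≤ Ck * ∫ s in (0:ℝ)..t, φ s := by
    filter_upwards [heq1, hk2] with t h1 h2 ht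
    have : φ t = ‖L t‖ := Set.indicator_of_mem ht _
    rw [this]
    refine ContinuousLinearMap.opNorm_le_bound _ (mul_nonneg hCk
      (intervalIntegral.integral_nonneg ht.1 (fun s _ => hφ0 s))) fun v => ?_
    have e : L t v = ∫ s in (0:ℝ)..t, k t s * (a (u s) v + b v (p s)) := by
      rw [← h1 ht v]; simp [hL]
    rw [e, ← intervalIntegral.integral_const_mul, ← intervalIntegral.integral_mul_const]
    refine intervalIntegral.norm_integral_le_of_norm_le ht.1 ?_
      ((hφ.intervalIntegrable.const_mul Ck).mul_const _)
    filter_upwards [h2] with s hs hst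
    have hm : s ∈ Set.Icc (0:ℝ) T := ⟨hst.1.le, hst.2.trans ht.2⟩
    have e2 : φ s = ‖L s‖ := Set.indicator_of_mem hm _
    have e3 : a (u s) v + b v (p s) = L s v := by simp [hL]
    rw [e2, e3, norm_mul, mul_assoc]
    exact mul_le_mul (hs hst.1.le hst.2 ht.2) ((L s).le_opNorm v) (norm_nonneg _) hCk
  filter_upwards [aux_gronwall_s7 T Ck hCk φ hφ hφ0 hkey, heq2, hg₀] with t h1 h2 h3 ht
  have e : φ t = ‖L t‖ := Set.indicator_of_mem ht _
  have hz := h1 ht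
  rw [e, norm_le_zero_iff] at hz
  obtain ⟨d1, d2, d3⟩ := hdec t
  exact aux_static a b c ha_symm ha_pos hc_symm hc_pos β hβ hinfsupQ hinfsupV (u t) (u₀ t) (ubar t)
    (p t) (g t) (gbar t) hz (h2 ht) (h3 ht) d1 d2 d3 (hgbar t).1 (hgbar t).2
end
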